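/- arXiv:2410.10731 — 5 statements merged into one kernel-verified Lean document; each statement's English description precedes it below -/
import Mathlib

section
/- Let n, A ≥ 1 be integers, s ∈ ℝ, 0 < p_1 < p_0 = ∞ and 0 < q_0 < q_1 ≤ ∞. Then the natural embedding ℓ^{q_0}((2^{js}·ℓ^{∞}{1,…,2^{nj}})_{j≥A}) ↪ ℓ^{q_1}((2^{j(s−n/p_1)}·ℓ^{p_1}{1,…,2^{nj}})_{j≥A}) is finitely strictly singular. -/
/-!
STATEMENT 10: Let n, A ≥ 1 be integers, s ∈ ℝ, 0 < p₁ < p₀ = ∞ and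
0 < q₀ < q₁ ≤ ∞.  Then the natural embedding
  ℓ^{q₀}((2^{js}·ℓ^∞{1,…,2^{nj}})_{j≥A}) ↪ ℓ^{q₁}((2^{j(s−n/p₁)}·ℓ^{p₁}{1,…,2^{nj}})_{j≥A})
is finitely strictly singular.

The spaces are modelled by reindexing `j ↦ A + j`: the coordinate of index
`j : ℕ` carries the block `ℝ^{2^{n(A+j)}}`.
-/

open scoped ENNReal

namespace Stmt10

/-- The `ℓ^q`-norm of a family of extended-nonnegative numbers. -/
noncomputable def eSeqNorm {ι : Type*} (q : ℝ≥0∞) (f : ι → ℝ≥0∞) : ℝ≥0∞ :=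
  if q = ∞ then ⨆ i, f i else (∑' i, f i ^ q.toReal) ^ (1 / q.toReal)

/-- The scalar `ℓ^p`-(quasi-)norm of a real sequence. -/
noncomputable def elpNorm {ι : Type*} (p : ℝ≥0∞) (a : ι → ℝ) : ℝ≥0∞ :=
  eSeqNorm p fun i => ENNReal.ofReal |a i|

/-- The norm of `ℓ^q((2^{j(s−n/p)}·ℓ^p{1,…,2^{nj}})_{j≥A})` (reindexed by
`j ↦ A + j`), with the convention `n/∞ = 0`. -/
noncomputable def besovBlockNorm (n A : ℕ) (s : ℝ) (p q : ℝ≥0∞)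
    (x : ∀ j : ℕ, Fin (2 ^ (n * (A + j))) → ℝ) : ℝ≥0∞ :=
  eSeqNorm q fun j : ℕ =>
    (2 : ℝ≥0∞) ^ (((A + j : ℕ) : ℝ) * (s - n * p.toReal⁻¹)) * elpNorm p (x j)

/-- `T` is finitely strictly singular w.r.t. the norms `M₀`, `M₁`. -/
def FinStrictlySingular {V₀ V₁ : Type*} [AddCommGroup V₀] [Module ℝ V₀]
    [AddCommGroup V₁] [Module ℝ V₁]
    (M₀ : V₀ → ℝ≥0∞) (M₁ : V₁ → ℝ≥0∞) (T : V₀ →ₗ[ℝ] V₁) : Prop :=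
  ∀ ε : ℝ, 0 < ε → ∃ N : ℕ, ∀ Z : Submodule ℝ V₀, (∀ x ∈ Z, M₀ x ≠ ∞) →
    (N : Cardinal) ≤ Module.rank ℝ Z → ∃ x ∈ Z, M₀ x = 1 ∧ M₁ (T x) ≤ ENNReal.ofReal ε

/-- In a subspace of `ℝ^Ω`, the evaluation functional at some point is large compared with a given
weight. -/
theorem exists_large_coord {Ω : Type*} [Fintype Ω] (E : Submodule ℝ (EuclideanSpace ℝ Ω))
    (hE : 0 < Module.finrank ℝ E) (w : Ω → ℝ) (hw : ∀ t, 0 < w t) :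
    ∃ u ∈ E, u ≠ 0 ∧ ∃ t, Module.finrank ℝ E * w t * ‖u‖ ^ 2 ≤ (∑ t, w t) * u t ^ 2 := by
  classical
  set N := Module.finrank ℝ E
  let b := stdOrthonormalBasis ℝ E
  let g : Ω → ℝ := fun t => ∑ i, (b i : EuclideanSpace ℝ Ω) t ^ 2
  have hg : ∑ t, g t = N := by
    simp only [g]
    rw [Finset.sum_comm]
    have : ∀ i, ∑ t, (b i : EuclideanSpace ℝ Ω) t ^ 2 = 1 := by
      intro i
      rw [← EuclideanSpace.real_norm_sq_eq]
      have := b.orthonormal.1 i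
      rw [Submodule.coe_norm] at this
      simp [this]
    simp [this, N]
  have hΩ : Nonempty Ω := by
    by_contra h
    rw [not_nonempty_iff] at h
    have h0 : (N : ℝ) = 0 := by simpa using hg.symm
    have : N = 0 := by exact_mod_cast h0
    omega
  have hW : 0 < ∑ t, w t := Finset.sum_pos (fun t _ => hw t) Finset.univ_nonempty
  obtain ⟨t, ht⟩ : ∃ t, N * w t ≤ (∑ t, w t) * g t := by
    by_contra! h
    have := Finset.sum_lt_sum_of_nonempty (s := Finset.univ) Finset.univ_nonempty fun t _ => h t
    rw [← Finset.mul_sum, ← Finset.mul_sum, hg] at this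
    linarith [mul_comm (N : ℝ) (∑ t, w t)]
  have hN : (0 : ℝ) < N := by exact_mod_cast hE
  have hgt : 0 < g t := by
    by_contra! h
    nlinarith [mul_pos hN (hw t)]
  let u : E := ∑ i, (b i : EuclideanSpace ℝ Ω) t • b i
  have hut : (u : EuclideanSpace ℝ Ω) t = g t := by
    simp [u, g, pow_two]
  have hun : ‖(u : EuclideanSpace ℝ Ω)‖ ^ 2 = g t := by
    rw [← Submodule.coe_norm, ← real_inner_self_eq_norm_sq]
    simp only [u]
    rw [b.orthonormal.inner_sum]
    simp [g, pow_two]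
  refine ⟨u, u.2, ?_, t, ?_⟩
  · intro h
    rw [h] at hun
    simp at hun
    linarith
  · rw [hun, hut]
    nlinarith

/-- Greedy construction: if a subspace contains normalised vectors which are small on any prescribed
set of at most `K` blocks, then it contains a normalised vector which is small on all blocks. -/
theorem exists_small_of_selection {ε q : ℝ} (hε : 0 < ε) (hq : 0 < q) :
    ∃ (K : ℕ) (δ : ℝ), 0 < δ ∧ ∀ {V : Type*} [AddCommGroup V] [Module ℝ V] (Z : Submodule ℝ V)
      (l : ℕ → Seminorm ℝ V) (Q : V → ℝ), (∀ x ∈ Z, 0 ≤ Q x) →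
      (∀ x ∈ Z, ∀ c : ℝ, Q (c • x) = |c| * Q x) →
      (∀ x ∈ Z, ∀ (S : Finset ℕ) (a : ℝ), 0 ≤ a → (∀ j ∈ S, a ≤ l j x) →
        S.card * a ^ q ≤ Q x ^ q) →
      (∀ F : Finset ℕ, F.card ≤ K → ∃ y ∈ Z, Q y = 1 ∧ ∀ j ∈ F, l j y ≤ δ) →
      ∃ x ∈ Z, Q x = 1 ∧ ∀ j, l j x ≤ ε := by
  obtain ⟨k, hk⟩ := exists_nat_gt ((2 / ε) ^ q / (ε / 2) ^ q)
  rw [div_lt_iff₀ (by positivity)] at hk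
  set δ : ℝ := ε / (2 * (k + 1)) with hδ
  have hδ0 : 0 < δ := by positivity
  have hkδ : (k + 1) * δ = ε / 2 := by rw [hδ]; field_simp
  obtain ⟨K, hK⟩ := exists_nat_gt ((2 / ε) ^ q / δ ^ q)
  rw [div_lt_iff₀ (by positivity)] at hK
  refine ⟨K, δ, hδ0, ?_⟩
  intro V _ _ Z l Q hQ0 hQs hQc hsel
  by_contra! hC
  have hle : ∀ x ∈ Z, ∀ j, l j x ≤ Q x := by
    intro x hx j
    have := hQc x hx {j} (l j x) (apply_nonneg _ _) (by simp)
    simp only [Finset.card_singleton, Nat.cast_one, one_mul] at this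
    exact (Real.rpow_le_rpow_iff (apply_nonneg _ _) (hQ0 x hx) hq).1 this
  have hε1 : ε < 1 := by
    obtain ⟨y, hy, hy1, -⟩ := hsel ∅ (by simp)
    obtain ⟨j, hj⟩ := hC y hy hy1
    linarith [hle y hy j]
  have hbd : ∀ x ∈ Z, ∀ B, (∀ j, l j x ≤ B) → Q x ≤ B / ε := by
    intro x hx B hB
    rcases (hQ0 x hx).eq_or_lt with h | h
    · rw [← h]
      exact div_nonneg ((apply_nonneg _ _).trans (hB 0)) hε.le
    · obtain ⟨j, hj⟩ := hC ((Q x)⁻¹ • x) (Z.smul_mem _ hx)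
        (by rw [hQs x hx, abs_of_pos (by positivity), inv_mul_cancel₀ h.ne'])
      rw [map_smul_eq_mul, Real.norm_of_nonneg (by positivity), inv_mul_eq_div,
        lt_div_iff₀ h] at hj
      rw [le_div_iff₀ hε]
      linarith [hB j]
  have main : ∀ i : ℕ, i ≤ k → ∃ x ∈ Z, ∃ S : Finset ℕ, S.card = i ∧
      (∀ j ∈ S, ε - i * δ ≤ l j x) ∧ ∀ j, l j x ≤ 1 + i * δ := by
    intro i
    induction i with
    | zero => exact fun _ => ⟨0, Z.zero_mem, ∅, by simp, by simp, by simp⟩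
    | succ i ih =>
      intro hi
      obtain ⟨x, hx, S, hS, hSl, hxl⟩ := ih (by omega)
      have hik : (i : ℝ) * δ + δ ≤ ε / 2 - δ := by
        have : (i : ℝ) + 1 ≤ k := by exact_mod_cast hi
        nlinarith
      have hQx : Q x ≤ 2 / ε :=
        (hbd x hx _ hxl).trans (by gcongr; linarith)
      have hcard : ∀ F : Finset ℕ, (∀ j ∈ F, δ ≤ l j x) → F.card ≤ K := by
        intro F hF
        have h1 := hQc x hx F δ hδ0.le hF
        have h2 : Q x ^ q ≤ (2 / ε) ^ q := Real.rpow_le_rpow (hQ0 x hx) hQx hq.le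
        have h3 : (0 : ℝ) < δ ^ q := by positivity
        have : (F.card : ℝ) ≤ K := by nlinarith
        exact_mod_cast this
      have hfin : {j | δ ≤ l j x}.Finite := by
        by_contra h
        obtain ⟨F, hF, hFc⟩ := Set.Infinite.exists_subset_card_eq h (K + 1)
        have := hcard F fun j hj => hF hj
        omega
      obtain ⟨y, hy, hy1, hyl⟩ := hsel hfin.toFinset (hcard _ (by simp))
      simp only [Set.Finite.mem_toFinset, Set.mem_ofPred_eq] at hyl
      obtain ⟨m, hm⟩ := hC y hy hy1
      have hmx : l m x < δ := by
        by_contra! h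
        linarith [hyl m h, mul_nonneg (Nat.cast_nonneg (α := ℝ) i) hδ0.le]
      have hmS : m ∉ S := fun h => by linarith [hSl m h]
      have hlow : ∀ j, l j x - l j y ≤ l j (x + y) := fun j => by
        have := map_sub_le_add (l j) (x + y) y
        rw [add_sub_cancel_right] at this
        linarith
      refine ⟨x + y, Z.add_mem hx hy, insert m S, ?_, ?_, ?_⟩
      · rw [Finset.card_insert_of_notMem hmS, hS]
      · intro j hj
        push_cast
        rcases Finset.mem_insert.1 hj with rfl | hj
        · have := hlow j
          have := map_sub_le_add (l j) (x + y) x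
          rw [add_sub_cancel_left] at this
          linarith [mul_nonneg (Nat.cast_nonneg (α := ℝ) i) hδ0.le]
        · have := hSl j hj
          linarith [hlow j, hyl j (by linarith)]
      · intro j
        have h1 := map_add_le_add (l j) x y
        push_cast
        by_cases h : δ ≤ l j x
        · linarith [hyl j h, hxl j]
        · linarith [hle y hy j, mul_nonneg (Nat.cast_nonneg (α := ℝ) i) hδ0.le]
  obtain ⟨x, hx, S, hS, hSl, hxl⟩ := main k le_rfl
  have h1 := hQc x hx S (ε / 2) (by positivity) fun j hj => by linarith [hSl j hj]
  have hQx : Q x ≤ 2 / ε := (hbd x hx _ hxl).trans (by gcongr; linarith)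
  have h2 : Q x ^ q ≤ (2 / ε) ^ q := Real.rpow_le_rpow (hQ0 x hx) hQx hq.le
  rw [hS] at h1
  linarith

/-- The `j`-th block of `x`, scaled so that its Euclidean norm is the `L²`-norm of `v j • x j` with
respect to the normalised counting measure. -/
noncomputable def blockMap (d : ℕ → ℕ) (v : ℕ → ℝ) (j : ℕ) :
    (∀ j, Fin (d j) → ℝ) →ₗ[ℝ] EuclideanSpace ℝ (Fin (d j)) :=
  (WithLp.linearEquiv 2 ℝ (Fin (d j) → ℝ)).symm.toLinearMap ∘ₗ
    ((v j / √(d j)) • LinearMap.proj j)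

theorem norm_blockMap_sq (d : ℕ → ℕ) (v : ℕ → ℝ) (j : ℕ) (x : ∀ j, Fin (d j) → ℝ) :
    ‖blockMap d v j x‖ ^ 2 = ∑ i, (v j * x j i) ^ 2 / d j := by
  rw [EuclideanSpace.real_norm_sq_eq]
  refine Finset.sum_congr rfl fun i _ => ?_
  change (v j / √(d j) * x j i) ^ 2 = _
  rw [div_mul_eq_mul_div, div_pow, Real.sq_sqrt (Nat.cast_nonneg _)]

theorem exists_blockMap_small (d : ℕ → ℕ) (hd : ∀ j, 0 < d j) (v : ℕ → ℝ)
    (Z : Submodule ℝ (∀ j, Fin (d j) → ℝ)) (F : Finset ℕ) (N : ℕ) (hN : 0 < N)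
    (hZ : (N : Cardinal) ≤ Module.rank ℝ Z) :
    ∃ y ∈ Z, y ≠ 0 ∧ ((∀ j ∈ F, blockMap d v j y = 0) ∨
      ∃ j i, ∀ k ∈ F, N * ‖blockMap d v k y‖ ^ 2 ≤ F.card * (v j * y j i) ^ 2) := by
  classical
  let T : (∀ j, Fin (d j) → ℝ) →ₗ[ℝ] EuclideanSpace ℝ (Σ j : F, Fin (d j)) :=
    (WithLp.linearEquiv 2 ℝ _).symm.toLinearMap ∘ₗ
      LinearMap.pi fun t => (v t.1 / √(d t.1)) •
        ((LinearMap.proj t.2 : (Fin (d t.1) → ℝ) →ₗ[ℝ] ℝ) ∘ₗ LinearMap.proj t.1.1)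
  have hTt : ∀ x t, T x t ^ 2 = (v t.1 * x t.1 t.2) ^ 2 / d t.1 := by
    intro x t
    change (v t.1 / √(d t.1) * x t.1 t.2) ^ 2 = _
    rw [div_mul_eq_mul_div, div_pow, Real.sq_sqrt (Nat.cast_nonneg _)]
  have hT : ∀ x, ‖T x‖ ^ 2 = ∑ k ∈ F, ‖blockMap d v k x‖ ^ 2 := by
    intro x
    rw [EuclideanSpace.real_norm_sq_eq, Fintype.sum_sigma,
      ← Finset.sum_coe_sort F fun k => ‖blockMap d v k x‖ ^ 2]
    refine Finset.sum_congr rfl fun k _ => ?_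
    rw [norm_blockMap_sq]
    exact Finset.sum_congr rfl fun i _ => hTt x ⟨k, i⟩
  have hTk : ∀ x, ∀ k ∈ F, ‖blockMap d v k x‖ ^ 2 ≤ ‖T x‖ ^ 2 := by
    intro x k hk
    rw [hT]
    exact Finset.single_le_sum (f := fun k => ‖blockMap d v k x‖ ^ 2)
      (fun _ _ => sq_nonneg _) hk
  by_cases hinj : Function.Injective (T.domRestrict Z)
  · have : Module.Finite ℝ Z := Module.Finite.of_injective _ hinj
    have hr := LinearMap.finrank_range_of_inj hinj
    have hNr : N ≤ Module.finrank ℝ (LinearMap.range (T.domRestrict Z)) := by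
      rw [hr]
      rw [← Module.finrank_eq_rank] at hZ
      exact_mod_cast hZ
    have hd' : ∀ j, (0 : ℝ) < d j := fun j => by exact_mod_cast hd j
    obtain ⟨u, ⟨y, rfl⟩, hu, t, ht⟩ := exists_large_coord (LinearMap.range (T.domRestrict Z))
      (by omega) (fun t => ((d t.1 : ℝ))⁻¹) fun t => inv_pos.2 (hd' _)
    have hsum : ∑ t : (Σ j : F, Fin (d j)), ((d t.1 : ℝ))⁻¹ = F.card := by
      rw [Fintype.sum_sigma]
      simp [(hd' _).ne']
    rw [hsum, LinearMap.domRestrict_apply, hTt] at ht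
    refine ⟨y, y.2, ?_, Or.inr ⟨t.1, t.2, fun k hk => ?_⟩⟩
    · intro h
      apply hu
      rw [LinearMap.domRestrict_apply, h, map_zero]
    · have h1 : (N : ℝ) ≤ Module.finrank ℝ (LinearMap.range (T.domRestrict Z)) := by
        exact_mod_cast hNr
      have h2 : (Module.finrank ℝ (LinearMap.range (T.domRestrict Z)) : ℝ) * ‖T y‖ ^ 2 ≤
          F.card * (v t.1 * (y : ∀ j, Fin (d j) → ℝ) t.1 t.2) ^ 2 := by
        have := hd' t.1
        field_simp at ht
        linarith
      refine le_trans ?_ h2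
      exact mul_le_mul h1 (hTk y k hk) (sq_nonneg _) (Nat.cast_nonneg _)
  · rw [← LinearMap.ker_eq_bot, Submodule.eq_bot_iff] at hinj
    push Not at hinj
    obtain ⟨y, hy, hy0⟩ := hinj
    refine ⟨y, y.2, by simpa using hy0, Or.inl fun k hk => ?_⟩
    have h := hTk y k hk
    rw [LinearMap.mem_ker, LinearMap.domRestrict_apply] at hy
    rw [hy] at h
    simpa using h

/-- A subspace of large dimension contains a vector normalised in `ℓ^q(L^∞)` all of whose blocks
have small `L²`-norm. -/
theorem exists_all_blockMap_small {ε q : ℝ} (hε : 0 < ε) (hq : 0 < q) :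
    ∃ N : ℕ, ∀ (d : ℕ → ℕ) (_ : ∀ j, 0 < d j) (v : ℕ → ℝ) (_ : ∀ j, 0 < v j)
      (Z : Submodule ℝ (∀ j, Fin (d j) → ℝ)) (Q : (∀ j, Fin (d j) → ℝ) → ℝ)
      (_ : ∀ x ∈ Z, 0 ≤ Q x) (_ : ∀ x ∈ Z, ∀ c : ℝ, Q (c • x) = |c| * Q x)
      (_ : ∀ x ∈ Z, ∀ (S : Finset ℕ) (a : ℝ), 0 ≤ a → (∀ j ∈ S, ∃ i, a ≤ v j * |x j i|) →
        S.card * a ^ q ≤ Q x ^ q) (_ : (N : Cardinal) ≤ Module.rank ℝ Z),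
      ∃ x ∈ Z, Q x = 1 ∧ ∀ j, ‖blockMap d v j x‖ ≤ ε := by
  obtain ⟨K, δ, hδ, hK⟩ := exists_small_of_selection hε hq
  obtain ⟨N, hN⟩ := exists_nat_gt (K / δ ^ 2)
  rw [div_lt_iff₀ (by positivity)] at hN
  refine ⟨N + 1, fun d hd v hv Z Q hQ0 hQs hQc hZ => ?_⟩
  have hle : ∀ x ∈ Z, ∀ j i, v j * |x j i| ≤ Q x := by
    intro x hx j i
    have hnn : 0 ≤ v j * |x j i| := mul_nonneg (hv j).le (abs_nonneg _)
    have := hQc x hx {j} _ hnn (by simp only [Finset.mem_singleton]; rintro _ rfl; exact ⟨i, le_rfl⟩)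
    simp only [Finset.card_singleton, Nat.cast_one, one_mul] at this
    exact (Real.rpow_le_rpow_iff hnn (hQ0 x hx) hq).1 this
  have hsq : ∀ x ∈ Z, ∀ j i, (v j * x j i) ^ 2 ≤ Q x ^ 2 := by
    intro x hx j i
    rw [sq_le_sq, abs_mul, abs_of_pos (hv j), abs_of_nonneg (hQ0 x hx)]
    exact hle x hx j i
  have hpos : ∀ x ∈ Z, x ≠ 0 → 0 < Q x := by
    intro x hx h0
    refine (hQ0 x hx).lt_of_ne' fun h => h0 ?_
    ext j i
    have h1 := hle x hx j i
    rw [h] at h1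
    have h2 : |x j i| ≤ 0 := by
      by_contra! h3
      linarith [mul_pos (hv j) h3]
    simpa using h2
  have hd' : ∀ j, (0 : ℝ) < d j := fun j => by exact_mod_cast hd j
  refine hK Z (fun j => (normSeminorm ℝ _).comp (blockMap d v j)) Q hQ0 hQs ?_ ?_
  · intro x hx S a ha hS
    refine hQc x hx S a ha fun j hj => ?_
    by_contra! h
    have hj' : a ≤ ‖blockMap d v j x‖ := hS j hj
    have h1 : a ^ 2 ≤ ∑ i, (v j * x j i) ^ 2 / d j := by
      rw [← norm_blockMap_sq]
      gcongr
    have h2 : ∑ i, (v j * x j i) ^ 2 / d j < ∑ _i : Fin (d j), a ^ 2 / d j := by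
      have : Nonempty (Fin (d j)) := ⟨⟨0, hd j⟩⟩
      refine Finset.sum_lt_sum_of_nonempty Finset.univ_nonempty fun i _ => ?_
      refine div_lt_div_of_pos_right ?_ (hd' j)
      rw [sq_lt_sq, abs_mul, abs_of_pos (hv j), abs_of_nonneg ha]
      exact h i
    rw [Finset.sum_const, Finset.card_univ, Fintype.card_fin, nsmul_eq_mul,
      mul_div_cancel₀ _ (hd' j).ne'] at h2
    linarith
  · intro F hF
    obtain ⟨y, hy, hy0, h⟩ := exists_blockMap_small d hd v Z F (N + 1) (by omega) hZ
    have hQy := hpos y hy hy0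
    have key : ∀ k ∈ F, ‖blockMap d v k y‖ ≤ δ * Q y := by
      intro k hk
      rcases h with h | ⟨j, i, h⟩
      · rw [h k hk, norm_zero]
        positivity
      · have h1 := h k hk
        have h2 := hsq y hy j i
        have h3 : (F.card : ℝ) ≤ K := by exact_mod_cast hF
        refine abs_le_of_sq_le_sq' ?_ (by positivity) |>.2
        rw [mul_pow]
        push_cast at h1
        have h4 : (F.card : ℝ) * (v j * y j i) ^ 2 ≤ K * Q y ^ 2 := by gcongr
        have h5 : (K : ℝ) * Q y ^ 2 ≤ (N + 1) * δ ^ 2 * Q y ^ 2 := by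
          gcongr
          nlinarith [sq_nonneg δ]
        have h6 : (0 : ℝ) < N + 1 := by positivity
        refine le_of_mul_le_mul_left ?_ h6
        linarith
    refine ⟨(Q y)⁻¹ • y, Z.smul_mem _ hy, ?_, fun j hj => ?_⟩
    · rw [hQs y hy, abs_of_pos (by positivity), inv_mul_cancel₀ hQy.ne']
    · rw [map_smul_eq_mul, Real.norm_of_nonneg (by positivity), inv_mul_eq_div, div_le_iff₀ hQy]
      exact key j hj

theorem eSeqNorm_const_mul {ι : Type*} (q : ℝ≥0∞) (hq : 0 < q) (c : ℝ≥0∞) (f : ι → ℝ≥0∞) :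
    eSeqNorm q (fun i => c * f i) = c * eSeqNorm q f := by
  unfold eSeqNorm
  split_ifs with h
  · rw [ENNReal.mul_iSup]
  · have hq' := ENNReal.toReal_pos hq.ne' h
    simp_rw [ENNReal.mul_rpow_of_nonneg _ _ hq'.le]
    rw [ENNReal.tsum_mul_left, ENNReal.mul_rpow_of_nonneg _ _ (by positivity), ← ENNReal.rpow_mul,
      mul_one_div_cancel hq'.ne', ENNReal.rpow_one]

theorem besovBlockNorm_smul (n A : ℕ) (s : ℝ) (p q : ℝ≥0∞) (hp : 0 < p) (hq : 0 < q) (c : ℝ)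
    (x : ∀ j : ℕ, Fin (2 ^ (n * (A + j))) → ℝ) :
    besovBlockNorm n A s p q (c • x) = ENNReal.ofReal |c| * besovBlockNorm n A s p q x := by
  unfold besovBlockNorm
  rw [← eSeqNorm_const_mul q hq]
  congr 1
  ext j
  rw [mul_left_comm]
  congr 1
  unfold elpNorm
  rw [← eSeqNorm_const_mul p hp]
  congr 1
  ext i
  simp [abs_mul, ENNReal.ofReal_mul]

theorem ofReal_le_block (n A : ℕ) (s : ℝ) (x : ∀ j : ℕ, Fin (2 ^ (n * (A + j))) → ℝ) (j : ℕ)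
    (i : Fin (2 ^ (n * (A + j)))) :
    ENNReal.ofReal ((2 : ℝ) ^ (((A + j : ℕ) : ℝ) * s) * |x j i|) ≤
      (2 : ℝ≥0∞) ^ (((A + j : ℕ) : ℝ) * (s - n * (∞ : ℝ≥0∞).toReal⁻¹)) * elpNorm ∞ (x j) := by
  rw [ENNReal.ofReal_mul (by positivity), ← ENNReal.ofReal_rpow_of_pos two_pos]
  simp only [ENNReal.ofReal_ofNat, ENNReal.toReal_top, inv_zero, mul_zero, sub_zero]
  gcongr
  unfold elpNorm eSeqNorm
  rw [if_pos rfl]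
  exact le_iSup (fun i => ENNReal.ofReal |x j i|) i

theorem block_le_ofReal (n m : ℕ) (s : ℝ) (p : ℝ≥0∞) (hp : 0 < p) (hp' : p < ∞)
    (x : Fin (2 ^ (n * m)) → ℝ) (c : ℝ) (hc : 0 ≤ c)
    (h : ∑ i, ((2 : ℝ) ^ ((m : ℝ) * s) * |x i|) ^ p.toReal / (2 ^ (n * m) : ℕ) ≤ c ^ p.toReal) :
    (2 : ℝ≥0∞) ^ ((m : ℝ) * (s - n * p.toReal⁻¹)) * elpNorm p x ≤ ENNReal.ofReal c := by
  have hq := ENNReal.toReal_pos hp.ne' hp'.ne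
  set r := p.toReal
  have h2 : (2 : ℝ≥0∞) ^ ((m : ℝ) * (s - n * r⁻¹)) =
      ENNReal.ofReal ((2 : ℝ) ^ ((m : ℝ) * (s - n * r⁻¹))) := by
    rw [← ENNReal.ofReal_rpow_of_pos two_pos, ENNReal.ofReal_ofNat]
  have h3 : elpNorm p x = ENNReal.ofReal ((∑ i, |x i| ^ r) ^ (1 / r)) := by
    unfold elpNorm eSeqNorm
    rw [if_neg hp'.ne, tsum_fintype, ← ENNReal.ofReal_rpow_of_nonneg (by positivity) (by positivity),
      ENNReal.ofReal_sum_of_nonneg fun _ _ => by positivity]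
    simp_rw [← ENNReal.ofReal_rpow_of_nonneg (abs_nonneg _) hq.le]
    rfl
  rw [h2, h3, ← ENNReal.ofReal_mul (by positivity)]
  refine ENNReal.ofReal_le_ofReal ?_
  rw [← Real.rpow_le_rpow_iff (by positivity) hc hq, Real.mul_rpow (by positivity) (by positivity),
    ← Real.rpow_mul (by positivity), ← Real.rpow_mul (by positivity), one_div_mul_cancel hq.ne',
    Real.rpow_one]
  refine le_trans (le_of_eq ?_) h
  rw [Finset.mul_sum]
  refine Finset.sum_congr rfl fun i _ => ?_
  rw [Real.mul_rpow (by positivity) (by positivity), ← Real.rpow_mul (by positivity),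
    mul_div_right_comm]
  congr 1
  rw [Nat.cast_pow, Nat.cast_ofNat, ← Real.rpow_natCast, ← Real.rpow_sub two_pos]
  congr 1
  push_cast
  field_simp

/-- Interpolation of `L^p` between `L^∞` and `L²`, in Chebyshev form. -/
theorem sum_rpow_div_le {d : ℕ} {p η : ℝ} (hd : 0 < d) (hp : 0 < p) (hη : 0 < η) (z : Fin d → ℝ)
    (hz0 : ∀ i, 0 ≤ z i) (hz : ∀ i, z i ≤ 1) (h : ∑ i, z i ^ 2 / d ≤ η ^ 2 * η ^ p) :
    ∑ i, z i ^ p / d ≤ (2 ^ p⁻¹ * η) ^ p := by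
  have hd' : (0 : ℝ) < d := by exact_mod_cast hd
  have hpt : ∀ i, z i ^ p / d ≤ η ^ p / d + (z i ^ 2 / d) / η ^ 2 := by
    intro i
    have : z i ^ p ≤ η ^ p + z i ^ 2 / η ^ 2 := by
      rcases le_or_gt (z i) η with hi | hi
      · have := Real.rpow_le_rpow (hz0 i) hi hp.le
        have : 0 ≤ z i ^ 2 / η ^ 2 := by positivity
        linarith
      · have h1 := Real.rpow_le_one (hz0 i) (hz i) hp.le
        have h2 : 1 ≤ z i ^ 2 / η ^ 2 := by
          rw [one_le_div (by positivity)]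
          gcongr
        have : 0 ≤ η ^ p := by positivity
        linarith
    calc z i ^ p / d ≤ (η ^ p + z i ^ 2 / η ^ 2) / d := by gcongr
      _ = _ := by rw [add_div, div_right_comm (z i ^ 2)]
  calc ∑ i, z i ^ p / d ≤ ∑ i, (η ^ p / d + (z i ^ 2 / d) / η ^ 2) :=
        Finset.sum_le_sum fun i _ => hpt i
    _ = η ^ p + (∑ i, z i ^ 2 / d) / η ^ 2 := by
        rw [Finset.sum_add_distrib, Finset.sum_const, Finset.card_univ, Fintype.card_fin,
          nsmul_eq_mul, mul_div_cancel₀ _ hd'.ne', Finset.sum_div]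
    _ ≤ η ^ p + η ^ p := by
        gcongr
        rw [div_le_iff₀ (by positivity)]
        linarith
    _ = (2 ^ p⁻¹ * η) ^ p := by
        rw [Real.mul_rpow (by positivity) hη.le, ← Real.rpow_mul two_pos.le,
          inv_mul_cancel₀ hp.ne', Real.rpow_one]
        ring

theorem eSeqNorm_rpow {ι : Type*} {q : ℝ≥0∞} (hq : 0 < q) (hq' : q ≠ ∞) (f : ι → ℝ≥0∞) :
    eSeqNorm q f ^ q.toReal = ∑' i, f i ^ q.toReal := by
  unfold eSeqNorm
  rw [if_neg hq', ← ENNReal.rpow_mul,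
    one_div_mul_cancel (ENNReal.toReal_pos hq.ne' hq').ne', ENNReal.rpow_one]

theorem le_eSeqNorm {ι : Type*} {q : ℝ≥0∞} (hq : 0 < q) (f : ι → ℝ≥0∞) (i : ι) :
    f i ≤ eSeqNorm q f := by
  by_cases hq' : q = ∞
  · unfold eSeqNorm
    rw [if_pos hq']
    exact le_iSup f i
  · rw [← ENNReal.rpow_le_rpow_iff (ENNReal.toReal_pos hq.ne' hq'), eSeqNorm_rpow hq hq']
    exact ENNReal.le_tsum (f := fun i => f i ^ q.toReal) i

/-- Interpolation of `ℓ^{q₁}` between `ℓ^{q₀}` and `ℓ^∞`. -/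
theorem exists_eSeqNorm_le (q₀ q₁ : ℝ≥0∞) (hq₀ : 0 < q₀) (hq : q₀ < q₁) (ε : ℝ) (hε : 0 < ε) :
    ∃ τ : ℝ, 0 < τ ∧ ∀ {ι : Type*} (f g : ι → ℝ≥0∞), (∀ i, f i ≤ g i) → eSeqNorm q₀ g = 1 →
      (∀ i, f i ≤ ENNReal.ofReal τ) → eSeqNorm q₁ f ≤ ENNReal.ofReal ε := by
  by_cases hq₁ : q₁ = ∞
  · refine ⟨ε, hε, fun f g _ _ h => ?_⟩
    unfold eSeqNorm
    rw [if_pos hq₁]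
    exact iSup_le h
  · have hq₀' : q₀ ≠ ∞ := (hq.trans_le le_top).ne
    have h0 := ENNReal.toReal_pos hq₀.ne' hq₀'
    have h1 := ENNReal.toReal_pos (hq₀.trans hq).ne' hq₁
    have h01 : q₀.toReal < q₁.toReal := (ENNReal.toReal_lt_toReal hq₀' hq₁).2 hq
    have hsub : 0 < q₁.toReal - q₀.toReal := sub_pos.2 h01
    refine ⟨ε ^ (q₁.toReal / (q₁.toReal - q₀.toReal)), by positivity, fun f g hfg hg h => ?_⟩
    rw [← ENNReal.rpow_le_rpow_iff h1, eSeqNorm_rpow (hq₀.trans hq) hq₁]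
    have hg' := eSeqNorm_rpow hq₀ hq₀' g
    rw [hg, ENNReal.one_rpow] at hg'
    calc ∑' i, f i ^ q₁.toReal
        ≤ ∑' i, ENNReal.ofReal ε ^ q₁.toReal * g i ^ q₀.toReal := by
          refine ENNReal.tsum_le_tsum fun i => ?_
          calc f i ^ q₁.toReal
              = f i ^ (q₁.toReal - q₀.toReal) * f i ^ q₀.toReal := by
                rw [← ENNReal.rpow_add_of_nonneg _ _ hsub.le h0.le, sub_add_cancel]
            _ ≤ (ENNReal.ofReal (ε ^ (q₁.toReal / (q₁.toReal - q₀.toReal)))) ^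
                  (q₁.toReal - q₀.toReal) * g i ^ q₀.toReal := by
                gcongr
                · exact h i
                · exact hfg i
            _ = _ := by
                rw [← ENNReal.ofReal_rpow_of_pos hε, ← ENNReal.rpow_mul,
                  div_mul_cancel₀ _ hsub.ne']
      _ = ENNReal.ofReal ε ^ q₁.toReal := by rw [ENNReal.tsum_mul_left, ← hg', mul_one]

theorem statement10 (n A : ℕ) (hn : 1 ≤ n) (hA : 1 ≤ A) (s : ℝ)
    (p₁ q₀ q₁ : ℝ≥0∞) (hp₁ : 0 < p₁) (hp : p₁ < ∞) (hq₀ : 0 < q₀) (hq : q₀ < q₁) :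
    FinStrictlySingular (besovBlockNorm n A s ∞ q₀) (besovBlockNorm n A s p₁ q₁)
      (LinearMap.id : (∀ j : ℕ, Fin (2 ^ (n * (A + j))) → ℝ) →ₗ[ℝ] _) := by
  intro ε hε
  obtain ⟨τ, hτ, hτε⟩ := exists_eSeqNorm_le q₀ q₁ hq₀ hq ε hε
  have hq₀' : q₀ ≠ ∞ := (hq.trans_le le_top).ne
  have hqr := ENNReal.toReal_pos hq₀.ne' hq₀'
  have hpr := ENNReal.toReal_pos hp₁.ne' hp.ne
  set p := p₁.toReal with hp_def
  set η : ℝ := τ / 2 ^ p⁻¹ with hη_def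
  have hη : 0 < η := by positivity
  have hητ : 2 ^ p⁻¹ * η = τ := by rw [hη_def]; field_simp
  obtain ⟨N, hN⟩ := exists_all_blockMap_small (ε := √(η ^ 2 * η ^ p)) (by positivity) hqr
  refine ⟨N, fun Z hZ hrank => ?_⟩
  let v : ℕ → ℝ := fun j => (2 : ℝ) ^ (((A + j : ℕ) : ℝ) * s)
  have hv : ∀ j, 0 < v j := fun j => by positivity
  obtain ⟨x, hx, hQx, hxε⟩ := hN (fun j => 2 ^ (n * (A + j))) (fun j => by positivity) v hv Z
    (fun x => (besovBlockNorm n A s ∞ q₀ x).toReal) (fun _ _ => ENNReal.toReal_nonneg)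
    (fun x _ c => by
      rw [besovBlockNorm_smul _ _ _ _ _ ENNReal.zero_lt_top hq₀, ENNReal.toReal_mul,
        ENNReal.toReal_ofReal (abs_nonneg c)])
    (fun x hx S a ha hS => by
      rw [ENNReal.toReal_rpow]
      refine (ENNReal.ofReal_le_iff_le_toReal ?_).1 ?_
      · exact ENNReal.rpow_ne_top_of_nonneg hqr.le (hZ x hx)
      · unfold besovBlockNorm
        rw [eSeqNorm_rpow hq₀ hq₀']
        refine le_trans ?_ (ENNReal.sum_le_tsum S)
        rw [ENNReal.ofReal_mul (by positivity), ENNReal.ofReal_natCast, ← nsmul_eq_mul]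
        refine Finset.card_nsmul_le_sum _ _ _ fun j hj => ?_
        rw [← ENNReal.ofReal_rpow_of_nonneg ha hqr.le]
        obtain ⟨i, hi⟩ := hS j hj
        gcongr
        exact (ENNReal.ofReal_le_ofReal hi).trans (ofReal_le_block n A s x j i))
    hrank
  have hx1 : besovBlockNorm n A s ∞ q₀ x = 1 := by
    rwa [ENNReal.toReal_eq_one_iff] at hQx
  refine ⟨x, hx, hx1, ?_⟩
  have hb1 := fun j => (le_eSeqNorm hq₀ _ j).trans_eq hx1
  refine hτε _ _ (fun j => ?_) hx1 fun j => ?_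
  · have hfin := ne_top_of_le_ne_top ENNReal.one_ne_top (hb1 j)
    rw [← ENNReal.ofReal_toReal hfin]
    refine block_le_ofReal n (A + j) s p₁ hp₁ hp _ _ ENNReal.toReal_nonneg ?_
    rw [← Finset.sum_div, div_le_iff₀ (by positivity)]
    refine (Finset.sum_le_card_nsmul _ _ _ fun i _ => Real.rpow_le_rpow (by positivity)
      ((ENNReal.ofReal_le_iff_le_toReal hfin).1 (ofReal_le_block n A s x j i)) hpr.le).trans_eq ?_
    simp [mul_comm, p]
  · rw [← hητ]
    refine block_le_ofReal n (A + j) s p₁ hp₁ hp _ _ (by positivity) ?_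
    refine sum_rpow_div_le (by positivity) hpr hη _ (fun i => by positivity) (fun i => ?_) ?_
    · have := (ofReal_le_block n A s x j i).trans (hb1 j)
      rwa [ENNReal.ofReal_le_one] at this
    · have h := hxε j
      have h2 := norm_blockMap_sq (fun j => 2 ^ (n * (A + j))) v j x
      have h3 : ‖blockMap (fun j => 2 ^ (n * (A + j))) v j x‖ ^ 2 ≤ η ^ 2 * η ^ p := by
        rw [← Real.sq_sqrt (show 0 ≤ η ^ 2 * η ^ p by positivity)]
        gcongr
      rw [h2] at h3
      simpa only [mul_pow, sq_abs, LinearMap.id_apply, v] using h3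

end Stmt10
end

section
/- Let n, A ≥ 1 be integers, s ∈ ℝ, 0 < p_1 ≤ p_0 ≤ ∞ and 0 < q_0 < q_1 ≤ ∞, and suppose that either p_0 < ∞ or p_0 = p_1 = ∞. Then the natural embedding ℓ^{q_0}((2^{j(s−n/p_0)}·ℓ^{p_0}{1,…,2^{nj}})_{j≥A}) ↪ ℓ^{q_1}((2^{j(s−n/p_1)}·ℓ^{p_1}{1,…,2^{nj}})_{j≥A}) is strictly singular but not finitely strictly singular. -/
/-!
STATEMENT 11: Let n, A ≥ 1 be integers, s ∈ ℝ, 0 < p₁ ≤ p₀ ≤ ∞ and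
0 < q₀ < q₁ ≤ ∞, and suppose that either p₀ < ∞ or p₀ = p₁ = ∞.  Then the
natural embedding
  ℓ^{q₀}((2^{j(s−n/p₀)}·ℓ^{p₀}{1,…,2^{nj}})_{j≥A}) ↪ ℓ^{q₁}((2^{j(s−n/p₁)}·ℓ^{p₁}{1,…,2^{nj}})_{j≥A})
is strictly singular but not finitely strictly singular.

The spaces are modelled by reindexing `j ↦ A + j`: the coordinate of index
`j : ℕ` carries the block `ℝ^{2^{n(A+j)}}`, with the convention `n/∞ = 0`.
-/

open scoped ENNReal

namespace Stmt11

/-- The `ℓ^q`-norm of a family of extended-nonnegative numbers. -/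
noncomputable def eSeqNorm {ι : Type*} (q : ℝ≥0∞) (f : ι → ℝ≥0∞) : ℝ≥0∞ :=
  if q = ∞ then ⨆ i, f i else (∑' i, f i ^ q.toReal) ^ (1 / q.toReal)

/-- The scalar `ℓ^p`-(quasi-)norm of a real sequence. -/
noncomputable def elpNorm {ι : Type*} (p : ℝ≥0∞) (a : ι → ℝ) : ℝ≥0∞ :=
  eSeqNorm p fun i => ENNReal.ofReal |a i|

/-- The norm of `ℓ^q((2^{j(s−n/p)}·ℓ^p{1,…,2^{nj}})_{j≥A})` (reindexed by
`j ↦ A + j`), with the convention `n/∞ = 0`. -/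
noncomputable def besovBlockNorm (n A : ℕ) (s : ℝ) (p q : ℝ≥0∞)
    (x : ∀ j : ℕ, Fin (2 ^ (n * (A + j))) → ℝ) : ℝ≥0∞ :=
  eSeqNorm q fun j : ℕ =>
    (2 : ℝ≥0∞) ^ (((A + j : ℕ) : ℝ) * (s - n * p.toReal⁻¹)) * elpNorm p (x j)

/-- `T` is strictly singular w.r.t. the (extended-valued) norms `M₀`, `M₁`. -/
def StrictlySingular {V₀ V₁ : Type*} [AddCommGroup V₀] [Module ℝ V₀]
    [AddCommGroup V₁] [Module ℝ V₁]
    (M₀ : V₀ → ℝ≥0∞) (M₁ : V₁ → ℝ≥0∞) (T : V₀ →ₗ[ℝ] V₁) : Prop :=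
  ∀ Z : Submodule ℝ V₀, (∀ x ∈ Z, M₀ x ≠ ∞) → ¬ FiniteDimensional ℝ Z →
    ∀ ε : ℝ, 0 < ε → ∃ x ∈ Z, M₀ x = 1 ∧ M₁ (T x) < ENNReal.ofReal ε

/-- `T` is finitely strictly singular w.r.t. the norms `M₀`, `M₁`. -/
def FinStrictlySingular {V₀ V₁ : Type*} [AddCommGroup V₀] [Module ℝ V₀]
    [AddCommGroup V₁] [Module ℝ V₁]
    (M₀ : V₀ → ℝ≥0∞) (M₁ : V₁ → ℝ≥0∞) (T : V₀ →ₗ[ℝ] V₁) : Prop :=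
  ∀ ε : ℝ, 0 < ε → ∃ N : ℕ, ∀ Z : Submodule ℝ V₀, (∀ x ∈ Z, M₀ x ≠ ∞) →
    (N : Cardinal) ≤ Module.rank ℝ Z → ∃ x ∈ Z, M₀ x = 1 ∧ M₁ (T x) ≤ ENNReal.ofReal ε

theorem eSeqNorm_top {ι : Type*} (f : ι → ℝ≥0∞) : eSeqNorm ∞ f = ⨆ i, f i := if_pos rfl

theorem eSeqNorm_of_ne_top {ι : Type*} {q : ℝ≥0∞} (hq : q ≠ ∞) (f : ι → ℝ≥0∞) :
    eSeqNorm q f = (∑' i, f i ^ q.toReal) ^ (1 / q.toReal) := if_neg hq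

theorem eSeqNorm_mono {ι : Type*} (q : ℝ≥0∞) {f g : ι → ℝ≥0∞} (h : ∀ i, f i ≤ g i) :
    eSeqNorm q f ≤ eSeqNorm q g := by
  by_cases hq : q = ∞
  · subst hq
    rw [eSeqNorm_top, eSeqNorm_top]
    exact iSup_mono h
  · rw [eSeqNorm_of_ne_top hq, eSeqNorm_of_ne_top hq]
    gcongr
    exact h _

theorem eSeqNorm_const_mul {ι : Type*} {q : ℝ≥0∞} (hq : 0 < q) (c : ℝ≥0∞) (f : ι → ℝ≥0∞) :
    eSeqNorm q (fun i => c * f i) = c * eSeqNorm q f := by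
  by_cases hq' : q = ∞
  · subst hq'
    rw [eSeqNorm_top, eSeqNorm_top, ENNReal.mul_iSup]
  · have h0 : 0 < q.toReal := ENNReal.toReal_pos hq.ne' hq'
    rw [eSeqNorm_of_ne_top hq', eSeqNorm_of_ne_top hq']
    simp_rw [ENNReal.mul_rpow_of_nonneg _ _ h0.le]
    rw [ENNReal.tsum_mul_left, ENNReal.mul_rpow_of_nonneg _ _ (by positivity), ← ENNReal.rpow_mul,
      mul_one_div_cancel h0.ne', ENNReal.rpow_one]

theorem le_eSeqNorm {ι : Type*} {q : ℝ≥0∞} (hq : 0 < q) (f : ι → ℝ≥0∞) (i : ι) :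
    f i ≤ eSeqNorm q f := by
  by_cases hq' : q = ∞
  · subst hq'
    rw [eSeqNorm_top]
    exact le_iSup f i
  · have h0 : 0 < q.toReal := ENNReal.toReal_pos hq.ne' hq'
    rw [eSeqNorm_of_ne_top hq', one_div, ENNReal.le_rpow_inv_iff h0]
    exact ENNReal.le_tsum (f := fun i => f i ^ q.toReal) i

theorem eSeqNorm_max_le {ι : Type*} {q : ℝ≥0∞} (hq : 0 < q) (f g : ι → ℝ≥0∞) :
    eSeqNorm q (fun i => max (f i) (g i)) ≤
      2 ^ (q.toReal⁻¹) * max (eSeqNorm q f) (eSeqNorm q g) := by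
  by_cases hq' : q = ∞
  · subst hq'
    simp only [eSeqNorm_top, ENNReal.toReal_top, inv_zero, ENNReal.rpow_zero, one_mul]
    exact iSup_le fun i => max_le_max (le_iSup f i) (le_iSup g i)
  · have h0 : 0 < q.toReal := ENNReal.toReal_pos hq.ne' hq'
    simp only [eSeqNorm_of_ne_top hq', one_div]
    have hm : ∀ r : ℝ, 0 < r → Monotone fun x : ℝ≥0∞ => x ^ r :=
      fun r hr => ENNReal.monotone_rpow_of_nonneg hr.le
    rw [← (hm _ (inv_pos.2 h0)).map_max, ← ENNReal.mul_rpow_of_nonneg _ _ (inv_pos.2 h0).le]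
    gcongr
    calc ∑' i, max (f i) (g i) ^ q.toReal ≤ ∑' i, (f i ^ q.toReal + g i ^ q.toReal) := by
          refine ENNReal.tsum_le_tsum fun i => ?_
          rw [(hm _ h0).map_max]
          exact max_le le_self_add le_add_self
      _ = ∑' i, f i ^ q.toReal + ∑' i, g i ^ q.toReal := ENNReal.tsum_add
      _ ≤ _ := by
          rw [two_mul]
          exact add_le_add (le_max_left _ _) (le_max_right _ _)

theorem eSeqNorm_single {q : ℝ≥0∞} (hq : 0 < q) (f : ℕ → ℝ≥0∞) (j : ℕ) (h : ∀ i, i ≠ j → f i = 0) :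
    eSeqNorm q f = f j := by
  refine le_antisymm ?_ (le_eSeqNorm hq f j)
  by_cases hq' : q = ∞
  · subst hq'
    rw [eSeqNorm_top]
    refine iSup_le fun i => ?_
    by_cases hi : i = j
    · rw [hi]
    · simp [h i hi]
  · have h0 : 0 < q.toReal := ENNReal.toReal_pos hq.ne' hq'
    rw [eSeqNorm_of_ne_top hq', tsum_eq_single j, ← ENNReal.rpow_mul, mul_one_div_cancel h0.ne',
      ENNReal.rpow_one]
    intro i hi
    rw [h i hi, ENNReal.zero_rpow_of_pos h0]

theorem exists_eSeqNorm_lt {q₀ q₁ : ℝ≥0∞} (hq₀ : 0 < q₀) (hq : q₀ < q₁) {ε : ℝ} (hε : 0 < ε) :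
    ∃ η : ℝ≥0∞, 0 < η ∧ ∀ f : ℕ → ℝ≥0∞, eSeqNorm q₀ f = 1 → (∀ j, f j ≤ η) →
      eSeqNorm q₁ f < ENNReal.ofReal ε := by
  obtain ⟨δ, hδ, hδε⟩ := exists_between (ENNReal.ofReal_pos.2 hε)
  have hq₀' : q₀ ≠ ∞ := hq.ne_top
  have h0 : 0 < q₀.toReal := ENNReal.toReal_pos hq₀.ne' hq₀'
  by_cases hq₁ : q₁ = ∞
  · subst hq₁
    refine ⟨δ, hδ, fun f _ hf => ?_⟩
    rw [eSeqNorm_top]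
    exact (iSup_le hf).trans_lt hδε
  · have h01 : q₀.toReal < q₁.toReal := (ENNReal.toReal_lt_toReal hq₀' hq₁).2 hq
    have h1 := h0.trans h01
    refine ⟨δ ^ ((q₁.toReal - q₀.toReal) / q₁.toReal)⁻¹,
      ENNReal.rpow_pos hδ hδε.ne_top, fun f hf hfη => ?_⟩
    refine lt_of_le_of_lt ?_ hδε
    have hs : ∑' j, f j ^ q₀.toReal = 1 := by
      rw [eSeqNorm_of_ne_top hq₀'] at hf
      have := congrArg (fun x : ℝ≥0∞ => x ^ q₀.toReal) hf
      simpa [← ENNReal.rpow_mul, h0.ne'] using this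
    set η := δ ^ ((q₁.toReal - q₀.toReal) / q₁.toReal)⁻¹ with hη
    have hle : ∑' j, f j ^ q₁.toReal ≤ η ^ (q₁.toReal - q₀.toReal) := by
      calc ∑' j, f j ^ q₁.toReal
          ≤ ∑' j, η ^ (q₁.toReal - q₀.toReal) * f j ^ q₀.toReal := by
            refine ENNReal.tsum_le_tsum fun j => ?_
            have : f j ^ q₁.toReal = f j ^ (q₁.toReal - q₀.toReal) * f j ^ q₀.toReal := by
              rw [← ENNReal.rpow_add_of_nonneg _ _ (by linarith) h0.le, sub_add_cancel]
            rw [this]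
            gcongr
            exact hfη j
        _ = _ := by rw [ENNReal.tsum_mul_left, hs, mul_one]
    rw [eSeqNorm_of_ne_top hq₁]
    calc _ ≤ (η ^ (q₁.toReal - q₀.toReal)) ^ (1 / q₁.toReal) := by gcongr
      _ = δ := by
        rw [hη, ← ENNReal.rpow_mul, ← ENNReal.rpow_mul]
        have : ((q₁.toReal - q₀.toReal) / q₁.toReal)⁻¹ * ((q₁.toReal - q₀.toReal) * (1 / q₁.toReal))
            = 1 := by
          have : q₁.toReal - q₀.toReal ≠ 0 := by linarith
          field_simp
        rw [this, ENNReal.rpow_one]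

theorem elpNorm_add_le {ι : Type*} {p : ℝ≥0∞} (hp : 0 < p) (x y : ι → ℝ) :
    elpNorm p (x + y) ≤ 2 * 2 ^ p.toReal⁻¹ * max (elpNorm p x) (elpNorm p y) := by
  calc elpNorm p (x + y)
      ≤ eSeqNorm p fun i => 2 * max (ENNReal.ofReal |x i|) (ENNReal.ofReal |y i|) := by
        refine eSeqNorm_mono p fun i => ?_
        rw [two_mul]
        calc ENNReal.ofReal |x i + y i| ≤ ENNReal.ofReal (|x i| + |y i|) :=
              ENNReal.ofReal_le_ofReal (abs_add_le _ _)
          _ = ENNReal.ofReal |x i| + ENNReal.ofReal |y i| :=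
              ENNReal.ofReal_add (abs_nonneg _) (abs_nonneg _)
          _ ≤ _ := add_le_add (le_max_left _ _) (le_max_right _ _)
    _ ≤ _ := by
        rw [eSeqNorm_const_mul hp, mul_assoc]
        gcongr
        exact eSeqNorm_max_le hp _ _

theorem elpNorm_smul {ι : Type*} {p : ℝ≥0∞} (hp : 0 < p) (c : ℝ) (x : ι → ℝ) :
    elpNorm p (c • x) = ENNReal.ofReal |c| * elpNorm p x := by
  simp only [elpNorm, Pi.smul_apply, smul_eq_mul, abs_mul, ENNReal.ofReal_mul (abs_nonneg c)]
  exact eSeqNorm_const_mul hp _ _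

theorem eq_zero_of_elpNorm_eq_zero {ι : Type*} {p : ℝ≥0∞} (hp : 0 < p) {x : ι → ℝ}
    (h : elpNorm p x = 0) : x = 0 := by
  funext i
  have := le_eSeqNorm hp (fun i => ENNReal.ofReal |x i|) i
  rw [elpNorm] at h
  rw [h] at this
  simpa using this

theorem elpNorm_of_ne_top {ι : Type*} [Fintype ι] {p : ℝ≥0∞} (hp : 0 < p) (hp' : p ≠ ∞)
    (x : ι → ℝ) :
    elpNorm p x = ENNReal.ofReal ((∑ i, |x i| ^ p.toReal) ^ (1 / p.toReal)) := by
  have h0 : 0 < p.toReal := ENNReal.toReal_pos hp.ne' hp'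
  rw [elpNorm, eSeqNorm_of_ne_top hp', tsum_fintype,
    ← ENNReal.ofReal_rpow_of_nonneg (by positivity) (by positivity),
    ENNReal.ofReal_sum_of_nonneg (fun i _ => by positivity)]
  simp_rw [ENNReal.ofReal_rpow_of_nonneg (abs_nonneg _) h0.le]

theorem exists_mem_ne_zero_forall_lt {E : ℕ → Type*} [∀ j, AddCommGroup (E j)]
    [∀ j, Module ℝ (E j)] [∀ j, FiniteDimensional ℝ (E j)] {Z : Submodule ℝ (∀ j, E j)}
    (hZ : ¬ FiniteDimensional ℝ Z) (m : ℕ) : ∃ x ∈ Z, x ≠ 0 ∧ ∀ j < m, x j = 0 := by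
  by_contra! hcon
  let T : (∀ j, E j) →ₗ[ℝ] (∀ j : Fin m, E j) := LinearMap.pi fun j => LinearMap.proj (j : ℕ)
  refine hZ (Module.Finite.of_injective (T ∘ₗ Z.subtype) ?_)
  rw [← LinearMap.ker_eq_bot, LinearMap.ker_eq_bot']
  intro x hx
  by_contra hne
  obtain ⟨j, hj, hj'⟩ := hcon x x.2 (fun h => hne (Subtype.ext h))
  exact hj' (congrFun hx ⟨j, hj⟩)

/-- Gliding hump: an infinite-dimensional subspace of a `c₀`-sum of finite-dimensional quasi-normed
spaces contains uniformly bounded vectors with arbitrarily many blocks of norm at least one. -/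
theorem exists_forall_le_sq_and_card_eq {E : ℕ → Type*} [∀ j, AddCommGroup (E j)]
    [∀ j, Module ℝ (E j)] [∀ j, FiniteDimensional ℝ (E j)] (b : ∀ j, E j → ℝ≥0∞)
    {C : ℝ≥0∞} (hC1 : 1 ≤ C) (hC : C ≠ ∞)
    (hadd : ∀ j x y, b j (x + y) ≤ C * max (b j x) (b j y))
    (hsmul : ∀ j (c : ℝ) x, b j (c • x) = ENNReal.ofReal |c| * b j x)
    (hzero : ∀ j x, b j x = 0 → x = 0)
    {Z : Submodule ℝ (∀ j, E j)} (hZ : ¬ FiniteDimensional ℝ Z)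
    (hbdd : ∀ x ∈ Z, ⨆ j, b j (x j) ≠ ∞)
    (hlim : ∀ x ∈ Z, Filter.Tendsto (fun j => b j (x j)) Filter.atTop (nhds 0)) (k : ℕ) :
    ∃ y ∈ Z, (∀ j, b j (y j) ≤ 2 * C ^ 2) ∧
      ∃ S : Finset ℕ, S.card = k ∧ ∀ j ∈ S, 1 ≤ b j (y j) := by
  have hb0 : ∀ j, b j 0 = 0 := fun j => by simpa using hsmul j 0 0
  induction k with
  | zero => exact ⟨0, Z.zero_mem, fun j => by simp [hb0], ∅, by simp⟩
  | succ k ih =>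
    obtain ⟨y, hy, hyC, S, hS, hyS⟩ := ih
    obtain ⟨m₀, hm₀⟩ := Filter.eventually_atTop.1 ((hlim y hy).eventually_lt_const one_pos)
    obtain ⟨m₁, hm₁⟩ := S.exists_nat_subset_range
    set m := max m₀ m₁
    obtain ⟨x, hx, hx0, hxm⟩ := exists_mem_ne_zero_forall_lt hZ m
    set M := ⨆ j, b j (x j)
    have hMtop : M ≠ ∞ := hbdd x hx
    have hM0 : M ≠ 0 := by
      intro h
      refine hx0 (funext fun j => hzero j _ ?_)
      exact le_antisymm (h ▸ le_iSup (fun j => b j (x j)) j) bot_le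
    have hC0 : C ≠ 0 := (one_pos.trans_le hC1).ne'
    set c : ℝ := (2 * C / M).toReal
    have hcC : ENNReal.ofReal |c| = 2 * C / M := by
      rw [abs_of_nonneg ENNReal.toReal_nonneg, ENNReal.ofReal_toReal]
      exact ENNReal.div_ne_top (ENNReal.mul_ne_top (by norm_num) hC) hM0
    have hcx : ∀ j, b j ((c • x) j) ≤ 2 * C := by
      intro j
      rw [Pi.smul_apply, hsmul, hcC]
      calc _ ≤ 2 * C / M * M := by gcongr; exact le_iSup (fun j => b j (x j)) j
        _ = _ := ENNReal.div_mul_cancel hM0 hMtop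
    obtain ⟨j₀, hj₀⟩ : ∃ j, C < b j ((c • x) j) := by
      obtain ⟨j, hj⟩ := lt_iSup_iff.1 (ENNReal.half_lt_self hM0 hMtop)
      refine ⟨j, ?_⟩
      rw [Pi.smul_apply, hsmul, hcC]
      calc C = 2 * C / M * (M / 2) := by
            rw [← mul_div_assoc, ENNReal.div_mul_cancel hM0 hMtop, mul_comm,
              ENNReal.mul_div_cancel_right (by norm_num) (by norm_num)]
        _ < _ := by
            refine ENNReal.mul_lt_mul_right ?_ ?_ hj
            · exact (ENNReal.div_pos (by simp [hC0]) hMtop).ne'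
            · exact ENNReal.div_ne_top (ENNReal.mul_ne_top (by norm_num) hC) hM0
    have hlow : ∀ j < m, (y + c • x) j = y j := fun j hj => by simp [hxm j hj]
    have hjm : m ≤ j₀ := by
      by_contra! h
      rw [Pi.smul_apply, hxm j₀ h, smul_zero, hb0] at hj₀
      exact absurd hj₀ (not_lt_bot)
    have hj₀S : j₀ ∉ S := fun h => by
      have := Finset.mem_range.1 (hm₁ h)
      omega
    refine ⟨y + c • x, Z.add_mem hy (Z.smul_mem c hx), fun j => ?_, insert j₀ S, ?_, ?_⟩
    · rcases lt_or_ge j m with h | h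
      · rw [hlow j h]; exact hyC j
      · refine (hadd j _ _).trans ?_
        have h1 : b j (y j) ≤ 2 * C :=
          (hm₀ j ((le_max_left _ _).trans h)).le.trans (hC1.trans (le_mul_of_one_le_left' one_le_two))
        calc _ ≤ C * (2 * C) := by gcongr; exact max_le h1 (hcx j)
          _ = _ := by ring
    · rw [Finset.card_insert_of_notMem hj₀S, hS]
    · intro j hj
      rcases Finset.mem_insert.1 hj with rfl | hj
      · by_contra! hlt
        have h1 : (c • x) j = (y + c • x) j + (-1 : ℝ) • y j := by simp
        have h2 := hadd j ((y + c • x) j) ((-1 : ℝ) • y j)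
        rw [← h1, hsmul] at h2
        have h3 : max (b j ((y + c • x) j)) (ENNReal.ofReal |(-1 : ℝ)| * b j (y j)) ≤ 1 := by
          refine max_le hlt.le ?_
          simpa using (hm₀ j ((le_max_left _ _).trans hjm)).le
        exact absurd (hj₀.trans_le h2) (not_lt.2 ((mul_le_mul_right h3 C).trans_eq (mul_one C)))
      · rw [hlow j]
        · exact hyS j hj
        · exact (Finset.mem_range.1 (hm₁ hj)).trans_le (le_max_right _ _)

/-- The sign attached to a Boolean. -/
def boolSign (b : Bool) : ℝ := if b then 1 else -1

/-- The Rademacher sum `∑ aₖ εₖ` on the discrete cube. -/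
def rademacherSum {d : ℕ} (a : Fin d → ℝ) (ω : Fin d → Bool) : ℝ :=
  ∑ k, a k * boolSign (ω k)

theorem rademacherSum_smul {d : ℕ} (t : ℝ) (a : Fin d → ℝ) (ω : Fin d → Bool) :
    rademacherSum (t • a) ω = t * rademacherSum a ω := by
  simp [rademacherSum, Finset.mul_sum, mul_assoc]

theorem sum_exp_rademacherSum_le {d : ℕ} (a : Fin d → ℝ) :
    ∑ ω, Real.exp (rademacherSum a ω) ≤ 2 ^ d * Real.exp ((∑ k, a k ^ 2) / 2) := by
  have h1 : ∑ ω, Real.exp (rademacherSum a ω) = ∏ k, ∑ b : Bool, Real.exp (a k * boolSign b) := by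
    rw [Finset.prod_univ_sum, Fintype.piFinset_univ]
    exact Finset.sum_congr rfl fun ω _ => Real.exp_sum _ _
  have h2 : ∀ k, ∑ b : Bool, Real.exp (a k * boolSign b) = 2 * Real.cosh (a k) := by
    intro k
    simp [boolSign, Real.cosh_eq]
    ring
  calc ∑ ω, Real.exp (rademacherSum a ω) = ∏ k, (2 * Real.cosh (a k)) := by
        rw [h1]; exact Finset.prod_congr rfl fun k _ => h2 k
    _ ≤ ∏ k, (2 * Real.exp (a k ^ 2 / 2)) := by
        refine Finset.prod_le_prod (fun k _ => by positivity) fun k _ => ?_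
        have := Real.cosh_le_exp_half_sq (a k)
        linarith
    _ = _ := by
        rw [Finset.prod_mul_distrib, ← Real.exp_sum, Finset.sum_div]
        simp

theorem sum_boolSign_mul_boolSign {d : ℕ} {i k : Fin d} (h : i ≠ k) :
    ∑ ω : Fin d → Bool, boolSign (ω i) * boolSign (ω k) = 0 := by
  refine Finset.sum_involution (fun ω _ => Function.update ω i (!ω i)) ?_ ?_ ?_ ?_
  · intro ω _
    rw [Function.update_self, Function.update_of_ne h.symm]
    cases ω i <;> cases ω k <;> norm_num [boolSign]
  · intro ω _ _ h2
    have := congrFun h2 i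
    simp at this
  · simp
  · intro ω _
    simp

theorem sum_rademacherSum_sq {d : ℕ} (a : Fin d → ℝ) :
    ∑ ω, rademacherSum a ω ^ 2 = 2 ^ d * ∑ k, a k ^ 2 := by
  have h1 : ∀ ω, rademacherSum a ω ^ 2
      = ∑ i, ∑ k, a i * a k * (boolSign (ω i) * boolSign (ω k)) := by
    intro ω
    rw [rademacherSum, sq, Finset.sum_mul_sum]
    refine Finset.sum_congr rfl fun i _ => Finset.sum_congr rfl fun k _ => by ring
  simp_rw [h1]
  rw [Finset.sum_comm, Finset.mul_sum]
  refine Finset.sum_congr rfl fun i _ => ?_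
  rw [Finset.sum_comm, Finset.sum_eq_single i]
  · have : ∀ b, boolSign b * boolSign b = 1 := by intro b; cases b <;> simp [boolSign]
    simp [this]; ring
  · intro k _ hk
    rw [← Finset.mul_sum, sum_boolSign_mul_boolSign hk.symm, mul_zero]
  · simp

theorem abs_pow_le_factorial_mul_exp (k : ℕ) (t : ℝ) :
    |t| ^ k ≤ k.factorial * (Real.exp t + Real.exp (-t)) := by
  have h := Real.pow_div_factorial_le_exp |t| (abs_nonneg t) k
  rw [div_le_iff₀ (by positivity)] at h
  refine h.trans ?_
  rw [mul_comm]
  gcongr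
  rcases abs_choice t with h | h <;> rw [h]
  · linarith [Real.exp_pos (-t)]
  · linarith [Real.exp_pos t]

theorem sum_abs_rademacherSum_pow_le (k : ℕ) {d : ℕ} (a : Fin d → ℝ) (ha : ∑ i, a i ^ 2 = 1) :
    ∑ ω, |rademacherSum a ω| ^ k ≤ 2 ^ d * (2 * k.factorial * Real.exp (1 / 2)) := by
  have h1 := sum_exp_rademacherSum_le a
  have h2 := sum_exp_rademacherSum_le ((-1 : ℝ) • a)
  simp only [rademacherSum_smul, Pi.smul_apply, smul_eq_mul, neg_mul, one_mul, neg_sq, ha] at h1 h2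
  calc ∑ ω, |rademacherSum a ω| ^ k
      ≤ ∑ ω, k.factorial * (Real.exp (rademacherSum a ω) + Real.exp (-rademacherSum a ω)) :=
        Finset.sum_le_sum fun ω _ => abs_pow_le_factorial_mul_exp k _
    _ = k.factorial * (∑ ω, Real.exp (rademacherSum a ω) + ∑ ω, Real.exp (-rademacherSum a ω)) := by
        rw [← Finset.mul_sum, Finset.sum_add_distrib]
    _ ≤ k.factorial * (2 ^ d * Real.exp (1 / 2) + 2 ^ d * Real.exp (1 / 2)) := by gcongr
    _ = _ := by ring

theorem exists_sum_abs_rademacherSum_rpow_le (P : ℝ) (hP : 0 < P) :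
    ∃ K > 0, ∀ (d : ℕ) (a : Fin d → ℝ), ∑ i, a i ^ 2 = 1 →
      ∑ ω, |rademacherSum a ω| ^ P ≤ 2 ^ d * K := by
  refine ⟨1 + 2 * (⌈P⌉₊).factorial * Real.exp (1 / 2), by positivity, fun d a ha => ?_⟩
  have hpt : ∀ t : ℝ, |t| ^ P ≤ 1 + |t| ^ ⌈P⌉₊ := by
    intro t
    rcases le_total |t| 1 with h | h
    · have := Real.rpow_le_one (abs_nonneg t) h hP.le
      have : 0 ≤ |t| ^ ⌈P⌉₊ := by positivity
      linarith
    · have := Real.rpow_le_rpow_of_exponent_le h (Nat.le_ceil P)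
      rw [Real.rpow_natCast] at this
      linarith
  calc ∑ ω, |rademacherSum a ω| ^ P ≤ ∑ ω, (1 + |rademacherSum a ω| ^ ⌈P⌉₊) :=
        Finset.sum_le_sum fun ω _ => hpt _
    _ = 2 ^ d + ∑ ω, |rademacherSum a ω| ^ ⌈P⌉₊ := by simp [Finset.sum_add_distrib]
    _ ≤ 2 ^ d + 2 ^ d * (2 * (⌈P⌉₊).factorial * Real.exp (1 / 2)) := by
        gcongr; exact sum_abs_rademacherSum_pow_le _ a ha
    _ = _ := by ring

theorem sq_le_rpow_add_pow_four (P : ℝ) (hP : 0 < P) (R : ℝ) (hR : 0 < R) (t : ℝ) (ht : 0 ≤ t) :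
    t ^ 2 ≤ 1 / 4 + R ^ 2 * (2 ^ P * t ^ P) + t ^ 4 / R ^ 2 := by
  have h0 : 0 ≤ R ^ 2 * (2 ^ P * t ^ P) := by positivity
  have h1 : 0 ≤ t ^ 4 / R ^ 2 := by positivity
  rcases le_total t (1 / 2) with h | h
  · nlinarith
  rcases le_total t R with h' | h'
  · have h2 : 1 ≤ 2 ^ P * t ^ P := by
      rw [← Real.mul_rpow (by norm_num) ht]
      exact Real.one_le_rpow (by linarith) hP.le
    nlinarith
  · have : t ^ 2 ≤ t ^ 4 / R ^ 2 := by
      rw [le_div_iff₀ (by positivity)]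
      nlinarith [sq_nonneg t, mul_le_mul h' h' hR.le ht]
    linarith

theorem exists_le_sum_abs_rademacherSum_rpow (P : ℝ) (hP : 0 < P) :
    ∃ κ > 0, ∀ (d : ℕ) (a : Fin d → ℝ), ∑ i, a i ^ 2 = 1 →
      2 ^ d * κ ≤ ∑ ω, |rademacherSum a ω| ^ P := by
  set B : ℝ := 2 * (Nat.factorial 4) * Real.exp (1 / 2) with hB
  have hB0 : 0 < B := by positivity
  refine ⟨1 / (8 * B * 2 ^ P), by positivity, fun d a ha => ?_⟩
  have h4 := sum_abs_rademacherSum_pow_le 4 a ha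
  rw [← hB] at h4
  have h2 := sum_rademacherSum_sq a
  rw [ha, mul_one] at h2
  have hR : √(4 * B) ^ 2 = 4 * B := Real.sq_sqrt (by positivity)
  have hpt : ∀ ω, rademacherSum a ω ^ 2 ≤ 1 / 4 + 4 * B * (2 ^ P * |rademacherSum a ω| ^ P)
      + |rademacherSum a ω| ^ 4 / (4 * B) := by
    intro ω
    have := sq_le_rpow_add_pow_four P hP √(4 * B) (by positivity) |rademacherSum a ω| (abs_nonneg _)
    rwa [hR, sq_abs] at this
  have h := Finset.sum_le_sum fun ω (_ : ω ∈ Finset.univ) => hpt ω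
  rw [h2, Finset.sum_add_distrib, Finset.sum_add_distrib, ← Finset.mul_sum, ← Finset.mul_sum,
    ← Finset.sum_div, ← Finset.sum_div] at h
  have hc : ∑ _ω : Fin d → Bool, (1 : ℝ) = 2 ^ d := by simp
  have h5 : (∑ ω, |rademacherSum a ω| ^ 4) / (4 * B) ≤ 2 ^ d / 4 := by
    rw [div_le_iff₀ (by positivity)]; linarith
  rw [hc] at h
  rw [mul_one_div, div_le_iff₀ (by positivity)]
  linarith

/-- Khintchine's inequality, in the form of the equivalence of all `L^p` quasi-norms on the span
of the Rademacher functions. -/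
theorem exists_rademacherSum_mean_rpow_le (P₀ P₁ : ℝ) (hP₀ : 0 < P₀) (hP₁ : 0 < P₁) :
    ∃ c > 0, ∀ (d : ℕ) (a : Fin d → ℝ),
      c * ((2 ^ d)⁻¹ * ∑ ω, |rademacherSum a ω| ^ P₀) ^ (1 / P₀)
        ≤ ((2 ^ d)⁻¹ * ∑ ω, |rademacherSum a ω| ^ P₁) ^ (1 / P₁) := by
  obtain ⟨K, hK, hK'⟩ := exists_sum_abs_rademacherSum_rpow_le P₀ hP₀
  obtain ⟨κ, hκ, hκ'⟩ := exists_le_sum_abs_rademacherSum_rpow P₁ hP₁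
  refine ⟨κ ^ (1 / P₁) / K ^ (1 / P₀), by positivity, fun d a => ?_⟩
  obtain ⟨t, ht, ht2⟩ : ∃ t : ℝ, 0 ≤ t ∧ t ^ 2 = ∑ i, a i ^ 2 :=
    ⟨√(∑ i, a i ^ 2), Real.sqrt_nonneg _, Real.sq_sqrt (by positivity)⟩
  rcases ht.eq_or_lt with h0 | h0
  · rw [← h0] at ht2
    have hz : a = 0 := by
      funext i
      have := (Finset.sum_eq_zero_iff_of_nonneg (fun i _ => sq_nonneg (a i))).1
        (by rw [← ht2]; norm_num) i (Finset.mem_univ i)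
      simpa using this
    have hf : ∀ ω, rademacherSum a ω = 0 := by simp [hz, rademacherSum]
    simp [hf, Real.zero_rpow hP₀.ne', Real.zero_rpow hP₁.ne', Real.zero_rpow (inv_pos.2 hP₀).ne',
      Real.zero_rpow (inv_pos.2 hP₁).ne']
  set a' := t⁻¹ • a with ha'
  have haa : a = t • a' := by rw [ha', smul_smul, mul_inv_cancel₀ h0.ne', one_smul]
  have hn : ∑ i, a' i ^ 2 = 1 := by
    simp only [ha', Pi.smul_apply, smul_eq_mul, mul_pow]
    rw [← Finset.mul_sum, ← ht2]
    field_simp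
  have hs : ∀ P : ℝ, 0 < P → ((2 ^ d)⁻¹ * ∑ ω, |rademacherSum a ω| ^ P) ^ (1 / P)
      = t * ((2 ^ d)⁻¹ * ∑ ω, |rademacherSum a' ω| ^ P) ^ (1 / P) := by
    intro P hP
    have : (2 ^ d)⁻¹ * ∑ ω, |rademacherSum a ω| ^ P
        = t ^ P * ((2 ^ d)⁻¹ * ∑ ω, |rademacherSum a' ω| ^ P) := by
      conv_lhs => rw [haa]
      simp only [rademacherSum_smul, abs_mul, abs_of_pos h0,
        Real.mul_rpow h0.le (abs_nonneg _)]
      rw [← Finset.mul_sum]; ring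
    rw [this, Real.mul_rpow (by positivity) (by positivity), ← Real.rpow_mul h0.le,
      mul_one_div_cancel hP.ne', Real.rpow_one]
  rw [hs P₀ hP₀, hs P₁ hP₁]
  have e0 : ((2 ^ d)⁻¹ * ∑ ω, |rademacherSum a' ω| ^ P₀) ^ (1 / P₀) ≤ K ^ (1 / P₀) := by
    gcongr
    rw [inv_mul_le_iff₀ (by positivity)]
    exact hK' d a' hn
  have e1 : κ ^ (1 / P₁) ≤ ((2 ^ d)⁻¹ * ∑ ω, |rademacherSum a' ω| ^ P₁) ^ (1 / P₁) := by
    gcongr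
    rw [le_inv_mul_iff₀ (by positivity)]
    exact hκ' d a' hn
  calc _ ≤ κ ^ (1 / P₁) / K ^ (1 / P₀) * (t * K ^ (1 / P₀)) := by gcongr
    _ = t * κ ^ (1 / P₁) := by field_simp
    _ ≤ _ := by gcongr

/-- The weighted `ℓ^p`-norm of a single block. -/
noncomputable def blockNorm (n J : ℕ) (s : ℝ) (p : ℝ≥0∞) (v : Fin (2 ^ (n * J)) → ℝ) : ℝ≥0∞ :=
  (2 : ℝ≥0∞) ^ ((J : ℝ) * (s - n * p.toReal⁻¹)) * elpNorm p v

theorem besovBlockNorm_eq (n A : ℕ) (s : ℝ) (p q : ℝ≥0∞)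
    (x : ∀ j : ℕ, Fin (2 ^ (n * (A + j))) → ℝ) :
    besovBlockNorm n A s p q x = eSeqNorm q fun j => blockNorm n (A + j) s p (x j) := rfl

theorem blockNorm_smul (n J : ℕ) (s : ℝ) {p : ℝ≥0∞} (hp : 0 < p) (c : ℝ)
    (v : Fin (2 ^ (n * J)) → ℝ) :
    blockNorm n J s p (c • v) = ENNReal.ofReal |c| * blockNorm n J s p v := by
  rw [blockNorm, blockNorm, elpNorm_smul hp, mul_left_comm]

theorem blockNorm_add_le (n J : ℕ) (s : ℝ) {p : ℝ≥0∞} (hp : 0 < p)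
    (v w : Fin (2 ^ (n * J)) → ℝ) :
    blockNorm n J s p (v + w)
      ≤ 2 * 2 ^ p.toReal⁻¹ * max (blockNorm n J s p v) (blockNorm n J s p w) := by
  simp only [blockNorm]
  rw [← mul_max, mul_left_comm]
  gcongr
  exact elpNorm_add_le hp v w

theorem eq_zero_of_blockNorm_eq_zero {n J : ℕ} {s : ℝ} {p : ℝ≥0∞} (hp : 0 < p)
    {v : Fin (2 ^ (n * J)) → ℝ} (h : blockNorm n J s p v = 0) : v = 0 := by
  rcases mul_eq_zero.1 h with h | h
  · exact absurd h (ENNReal.rpow_pos (by norm_num) (by norm_num)).ne'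
  · exact eq_zero_of_elpNorm_eq_zero hp h

theorem blockNorm_zero (n J : ℕ) (s : ℝ) {p : ℝ≥0∞} (hp : 0 < p) :
    blockNorm n J s p 0 = 0 := by
  simpa using blockNorm_smul n J s hp 0 0

/-- A block norm is, up to a factor independent of `p`, a normalised `L^p`-norm. -/
theorem blockNorm_of_ne_top (n J : ℕ) (s : ℝ) {p : ℝ≥0∞} (hp : 0 < p) (hp' : p ≠ ∞)
    (v : Fin (2 ^ (n * J)) → ℝ) :
    blockNorm n J s p v = ENNReal.ofReal (2 ^ (J * s) *
      ((2 ^ (n * J))⁻¹ * ∑ i, |v i| ^ p.toReal) ^ (1 / p.toReal)) := by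
  have h2 : (2 : ℝ≥0∞) = ENNReal.ofReal 2 := by simp
  rw [blockNorm, elpNorm_of_ne_top hp hp', h2, ENNReal.ofReal_rpow_of_pos two_pos,
    ← ENNReal.ofReal_mul (by positivity)]
  congr 1
  rw [Real.mul_rpow (by positivity) (by positivity), ← mul_assoc]
  congr 1
  rw [mul_sub, Real.rpow_sub two_pos, div_eq_mul_inv]
  congr 1
  rw [← Real.rpow_natCast, Real.inv_rpow (by positivity), ← Real.rpow_mul two_pos.le]
  congr 2
  push_cast
  ring

theorem blockNorm_ne_top (n J : ℕ) (s : ℝ) {p : ℝ≥0∞} (hp : 0 < p)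
    (v : Fin (2 ^ (n * J)) → ℝ) : blockNorm n J s p v ≠ ∞ := by
  by_cases hp' : p = ∞
  · subst hp'
    refine ENNReal.mul_ne_top (ENNReal.rpow_ne_top_of_ne_zero (by norm_num) (by norm_num)) ?_
    rw [elpNorm, eSeqNorm_top]
    exact (iSup_lt_iff.2 ⟨ENNReal.ofReal ‖v‖, ENNReal.ofReal_lt_top, fun i =>
      ENNReal.ofReal_le_ofReal (norm_le_pi_norm v i)⟩).ne
  · rw [blockNorm_of_ne_top n J s hp hp']
    exact ENNReal.ofReal_ne_top

theorem blockNorm_mono_exponent (n J : ℕ) (s : ℝ) {p₀ p₁ : ℝ≥0∞} (hp₁ : 0 < p₁) (hp : p₁ ≤ p₀)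
    (hp₀ : p₀ ≠ ∞) (v : Fin (2 ^ (n * J)) → ℝ) :
    blockNorm n J s p₁ v ≤ blockNorm n J s p₀ v := by
  have hp₁' : p₁ ≠ ∞ := ne_top_of_le_ne_top hp₀ hp
  rw [blockNorm_of_ne_top n J s hp₁ hp₁', blockNorm_of_ne_top n J s (hp₁.trans_le hp) hp₀]
  have h1 : 0 < p₁.toReal := ENNReal.toReal_pos hp₁.ne' hp₁'
  have h01 : p₁.toReal ≤ p₀.toReal := ENNReal.toReal_mono hp₀ hp
  have h0 := h1.trans_le h01
  refine ENNReal.ofReal_le_ofReal (mul_le_mul_of_nonneg_left ?_ (by positivity))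
  have key := Real.rpow_arith_mean_le_arith_mean_rpow Finset.univ
    (fun _ : Fin (2 ^ (n * J)) => ((2 : ℝ) ^ (n * J))⁻¹) (fun i => |v i| ^ p₁.toReal)
    (fun _ _ => by positivity) (by simp) (fun _ _ => by positivity) ((one_le_div h1).2 h01)
  simp_rw [← Real.rpow_mul (abs_nonneg _), mul_div_cancel₀ _ h1.ne', ← Finset.mul_sum] at key
  calc ((2 ^ (n * J))⁻¹ * ∑ i, |v i| ^ p₁.toReal) ^ (1 / p₁.toReal)
      = (((2 ^ (n * J))⁻¹ * ∑ i, |v i| ^ p₁.toReal) ^ (p₀.toReal / p₁.toReal)) ^ (1 / p₀.toReal) := by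
        rw [← Real.rpow_mul (by positivity)]
        congr 1
        field_simp
    _ ≤ _ := by gcongr

/-- The embedding of the span of the Rademacher functions into a block. -/
noncomputable def rademacherMap (n J : ℕ) : (Fin (n * J) → ℝ) →ₗ[ℝ] Fin (2 ^ (n * J)) → ℝ where
  toFun a i := rademacherSum a ((Fintype.equivOfCardEq (by simp) :
    Fin (2 ^ (n * J)) ≃ (Fin (n * J) → Bool)) i)
  map_add' a b := by
    funext i
    simp [rademacherSum, add_mul, Finset.sum_add_distrib]
  map_smul' c a := by
    funext i
    simp [rademacherSum_smul]

theorem sum_rademacherMap (n J : ℕ) (a : Fin (n * J) → ℝ) (g : ℝ → ℝ) :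
    ∑ i, g (rademacherMap n J a i) = ∑ ω, g (rademacherSum a ω) :=
  Equiv.sum_comp (Fintype.equivOfCardEq (by simp) : Fin (2 ^ (n * J)) ≃ (Fin (n * J) → Bool))
    fun ω => g (rademacherSum a ω)

theorem rademacherMap_injective (n J : ℕ) : Function.Injective (rademacherMap n J) := by
  rw [← LinearMap.ker_eq_bot, LinearMap.ker_eq_bot']
  intro a ha
  have h := sum_rademacherMap n J a (· ^ 2)
  rw [ha, sum_rademacherSum_sq] at h
  have h0 : ∑ k, a k ^ 2 = 0 := by simpa using h.symm
  funext i
  simpa using (Finset.sum_eq_zero_iff_of_nonneg fun i _ => sq_nonneg (a i)).1 h0 i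
    (Finset.mem_univ i)

theorem exists_blockNorm_rademacherMap_le (n : ℕ) (s : ℝ) {p₀ p₁ : ℝ≥0∞} (hp₀ : 0 < p₀)
    (hp₁ : 0 < p₁) (hp₀' : p₀ ≠ ∞) (hp₁' : p₁ ≠ ∞) :
    ∃ c : ℝ, 0 < c ∧ ∀ (J : ℕ) (a : Fin (n * J) → ℝ),
      ENNReal.ofReal c * blockNorm n J s p₀ (rademacherMap n J a)
        ≤ blockNorm n J s p₁ (rademacherMap n J a) := by
  obtain ⟨c, hc, h⟩ := exists_rademacherSum_mean_rpow_le p₀.toReal p₁.toReal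
    (ENNReal.toReal_pos hp₀.ne' hp₀') (ENNReal.toReal_pos hp₁.ne' hp₁')
  refine ⟨c, hc, fun J a => ?_⟩
  rw [blockNorm_of_ne_top n J s hp₀ hp₀', blockNorm_of_ne_top n J s hp₁ hp₁',
    ← ENNReal.ofReal_mul hc.le, sum_rademacherMap n J a (|·| ^ p₀.toReal),
    sum_rademacherMap n J a (|·| ^ p₁.toReal), mul_left_comm]
  exact ENNReal.ofReal_le_ofReal (mul_le_mul_of_nonneg_left (h _ a) (by positivity))

theorem besovBlockNorm_single (n A : ℕ) (s : ℝ) {p q : ℝ≥0∞} (hp : 0 < p) (hq : 0 < q) (j : ℕ)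
    (v : Fin (2 ^ (n * (A + j))) → ℝ) :
    besovBlockNorm n A s p q (Pi.single j v) = blockNorm n (A + j) s p v := by
  rw [besovBlockNorm_eq, eSeqNorm_single hq _ j, Pi.single_eq_same]
  intro i hi
  rw [Pi.single_eq_of_ne hi, blockNorm_zero _ _ _ hp]

theorem besovBlockNorm_smul (n A : ℕ) (s : ℝ) {p q : ℝ≥0∞} (hp : 0 < p) (hq : 0 < q) (c : ℝ)
    (x : ∀ j : ℕ, Fin (2 ^ (n * (A + j))) → ℝ) :
    besovBlockNorm n A s p q (c • x) = ENNReal.ofReal |c| * besovBlockNorm n A s p q x := by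
  simp only [besovBlockNorm_eq, Pi.smul_apply, blockNorm_smul _ _ _ hp]
  exact eSeqNorm_const_mul hq _ _

theorem tendsto_zero_of_eSeqNorm_ne_top {q : ℝ≥0∞} (hq : 0 < q) (hq' : q ≠ ∞) {f : ℕ → ℝ≥0∞}
    (h : eSeqNorm q f ≠ ∞) : Filter.Tendsto f Filter.atTop (nhds 0) := by
  have h0 : 0 < q.toReal := ENNReal.toReal_pos hq.ne' hq'
  rw [eSeqNorm_of_ne_top hq'] at h
  have hs : ∑' j, f j ^ q.toReal ≠ ∞ := by
    intro hs
    rw [hs] at h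
    exact h (ENNReal.top_rpow_of_pos (by positivity))
  have ht := (ENNReal.tendsto_atTop_zero_of_tsum_ne_top hs).ennrpow_const q.toReal⁻¹
  simpa [← ENNReal.rpow_mul, h0.ne', ENNReal.zero_rpow_of_pos (inv_pos.2 h0)] using ht

theorem card_rpow_le_eSeqNorm {q : ℝ≥0∞} (hq : 0 < q) (hq' : q ≠ ∞) {f : ℕ → ℝ≥0∞}
    {S : Finset ℕ} (h : ∀ j ∈ S, 1 ≤ f j) : (S.card : ℝ≥0∞) ^ (1 / q.toReal) ≤ eSeqNorm q f := by
  rw [eSeqNorm_of_ne_top hq']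
  gcongr
  calc (S.card : ℝ≥0∞) = ∑ _j ∈ S, 1 := by simp
    _ ≤ ∑ j ∈ S, f j ^ q.toReal :=
        Finset.sum_le_sum fun j hj => ENNReal.one_le_rpow (h j hj) (ENNReal.toReal_pos hq.ne' hq')
    _ ≤ _ := ENNReal.sum_le_tsum S

/-- An infinite-dimensional subspace contains normalised vectors all of whose blocks are small. -/
theorem exists_besovBlockNorm_eq_one_and_blockNorm_le (n A : ℕ) (s : ℝ) {p q : ℝ≥0∞} (hp : 0 < p)
    (hq : 0 < q) (hq' : q ≠ ∞) {Z : Submodule ℝ (∀ j : ℕ, Fin (2 ^ (n * (A + j))) → ℝ)}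
    (hfin : ∀ x ∈ Z, besovBlockNorm n A s p q x ≠ ∞) (hZ : ¬ FiniteDimensional ℝ Z)
    {η : ℝ≥0∞} (hη : 0 < η) :
    ∃ x ∈ Z, besovBlockNorm n A s p q x = 1 ∧ ∀ j, blockNorm n (A + j) s p (x j) ≤ η := by
  have h0 : 0 < q.toReal := ENNReal.toReal_pos hq.ne' hq'
  set C : ℝ≥0∞ := 2 * 2 ^ p.toReal⁻¹
  have hC1 : 1 ≤ C := one_le_mul one_le_two
    (ENNReal.rpow_zero (x := 2) ▸ ENNReal.rpow_le_rpow_of_exponent_le one_le_two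
      (inv_nonneg.2 ENNReal.toReal_nonneg))
  have hCtop : C ≠ ∞ := ENNReal.mul_ne_top (by norm_num)
    (ENNReal.rpow_ne_top_of_ne_zero (by norm_num) (by norm_num))
  have hDtop : 2 * C ^ 2 / η ≠ ∞ :=
    ENNReal.div_ne_top (ENNReal.mul_ne_top (by norm_num) (ENNReal.pow_ne_top hCtop)) hη.ne'
  obtain ⟨k, hk⟩ := ENNReal.exists_nat_gt (ENNReal.rpow_ne_top_of_nonneg h0.le hDtop)
  obtain ⟨y, hy, hyC, S, hS, hyS⟩ := exists_forall_le_sq_and_card_eq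
    (fun j => blockNorm n (A + j) s p) hC1 hCtop (fun j => blockNorm_add_le n (A + j) s hp)
    (fun j => blockNorm_smul n (A + j) s hp) (fun j x => eq_zero_of_blockNorm_eq_zero hp) hZ
    (fun x hx => ne_top_of_le_ne_top (hfin x hx) (iSup_le (le_eSeqNorm hq _)))
    (fun x hx => tendsto_zero_of_eSeqNorm_ne_top hq hq' (hfin x hx)) k
  set M := besovBlockNorm n A s p q y
  have hMtop : M ≠ ∞ := hfin y hy
  have hkM : (k : ℝ≥0∞) ^ (1 / q.toReal) ≤ M := hS ▸ card_rpow_le_eSeqNorm hq hq' hyS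
  have hDM : 2 * C ^ 2 / η < M := by
    refine lt_of_lt_of_le ?_ hkM
    rwa [one_div, ENNReal.lt_rpow_inv_iff h0]
  have hM0 : M ≠ 0 := (bot_le.trans_lt hDM).ne'
  have hc : ENNReal.ofReal |M⁻¹.toReal| = M⁻¹ := by
    rw [abs_of_nonneg ENNReal.toReal_nonneg, ENNReal.ofReal_toReal (ENNReal.inv_ne_top.2 hM0)]
  refine ⟨M⁻¹.toReal • y, Z.smul_mem _ hy, ?_, fun j => ?_⟩
  · rw [besovBlockNorm_smul n A s hp hq, hc, ENNReal.inv_mul_cancel hM0 hMtop]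
  · rw [Pi.smul_apply, blockNorm_smul n _ s hp, hc]
    calc M⁻¹ * blockNorm n (A + j) s p (y j) ≤ M⁻¹ * (2 * C ^ 2) := by gcongr; exact hyC j
      _ ≤ M⁻¹ * (M * η) := mul_le_mul_right
        ((ENNReal.div_le_iff_le_mul (Or.inl hη.ne') (Or.inr hM0)).1 hDM.le) _
      _ = η := by rw [← mul_assoc, ENNReal.inv_mul_cancel hM0 hMtop, one_mul]

theorem statement11 (n A : ℕ) (hn : 1 ≤ n) (hA : 1 ≤ A) (s : ℝ)
    (p₀ p₁ q₀ q₁ : ℝ≥0∞) (hp₁ : 0 < p₁) (hp : p₁ ≤ p₀)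
    (hq₀ : 0 < q₀) (hq : q₀ < q₁)
    (hcase : p₀ < ∞ ∨ (p₀ = ∞ ∧ p₁ = ∞)) :
    StrictlySingular (besovBlockNorm n A s p₀ q₀) (besovBlockNorm n A s p₁ q₁)
      (LinearMap.id : (∀ j : ℕ, Fin (2 ^ (n * (A + j))) → ℝ) →ₗ[ℝ] _)
    ∧ ¬ FinStrictlySingular (besovBlockNorm n A s p₀ q₀) (besovBlockNorm n A s p₁ q₁)
      (LinearMap.id : (∀ j : ℕ, Fin (2 ^ (n * (A + j))) → ℝ) →ₗ[ℝ] _) := by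
  have hp₀ : 0 < p₀ := hp₁.trans_le hp
  have hmono : ∀ J v, blockNorm n J s p₁ v ≤ blockNorm n J s p₀ v := by
    intro J v
    rcases hcase with h | ⟨h, h'⟩
    · exact blockNorm_mono_exponent n J s hp₁ hp h.ne v
    · rw [h, h']
  have hcompare : ∃ c : ℝ, 0 < c ∧ ∀ (J : ℕ) (a : Fin (n * J) → ℝ),
      ENNReal.ofReal c * blockNorm n J s p₀ (rademacherMap n J a)
        ≤ blockNorm n J s p₁ (rademacherMap n J a) := by
    rcases hcase with h | ⟨h, h'⟩
    · exact exists_blockNorm_rademacherMap_le n s hp₀ hp₁ h.ne (hp.trans_lt h).ne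
    · exact ⟨1, one_pos, fun J a => by simp [h, h']⟩
  refine ⟨fun Z hfin hZ ε hε => ?_, fun hFSS => ?_⟩
  · obtain ⟨η, hη, hsmall⟩ := exists_eSeqNorm_lt hq₀ hq hε
    obtain ⟨x, hx, hx1, hxη⟩ :=
      exists_besovBlockNorm_eq_one_and_blockNorm_le n A s hp₀ hq₀ hq.ne_top hfin hZ hη
    exact ⟨x, hx, hx1, (eSeqNorm_mono q₁ fun j => hmono _ _).trans_lt (hsmall _ hx1 hxη)⟩
  · obtain ⟨c, hc, hcompare⟩ := hcompare
    obtain ⟨N, hN⟩ := hFSS (c / 2) (half_pos hc)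
    let T := (LinearMap.single ℝ (fun j : ℕ => Fin (2 ^ (n * (A + j))) → ℝ) N) ∘ₗ
      rademacherMap n (A + N)
    have hTinj : Function.Injective T :=
      (Pi.single_injective (M := fun j : ℕ => Fin (2 ^ (n * (A + j))) → ℝ) N).comp
        (rademacherMap_injective n (A + N))
    have hTnorm : ∀ (p q : ℝ≥0∞), 0 < p → 0 < q → ∀ a, besovBlockNorm n A s p q (T a)
        = blockNorm n (A + N) s p (rademacherMap n (A + N) a) :=
      fun p q hp hq a => besovBlockNorm_single n A s hp hq N _
    obtain ⟨x, ⟨a, rfl⟩, hx0, hx1⟩ := hN (LinearMap.range T) (by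
      rintro _ ⟨a, rfl⟩
      rw [hTnorm _ _ hp₀ hq₀]
      exact blockNorm_ne_top _ _ _ hp₀ _) (by
      rw [← (LinearEquiv.ofInjective T hTinj).rank_eq]
      simp only [rank_fun', Fintype.card_fin, Nat.cast_le]
      nlinarith)
    rw [hTnorm _ _ hp₀ hq₀] at hx0
    rw [LinearMap.id_apply, hTnorm _ _ hp₁ (hq₀.trans hq)] at hx1
    have h := (hcompare (A + N) a).trans hx1
    rw [hx0, mul_one, ENNReal.ofReal_le_ofReal_iff (half_pos hc).le] at h
    linarith

end Stmt11
end

section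
/- Let n, A ≥ 1 be integers, s ∈ ℝ, 0 < p_1 ≤ p_0 ≤ ∞ and 0 < q_0 = q_1 ≤ ∞. Then the natural embedding ℓ^{q_0}((2^{j(s−n/p_0)}·ℓ^{p_0}{1,…,2^{nj}})_{j≥A}) ↪ ℓ^{q_1}((2^{j(s−n/p_1)}·ℓ^{p_1}{1,…,2^{nj}})_{j≥A}) is not strictly singular. -/
/-!
STATEMENT 12: Let n, A ≥ 1 be integers, s ∈ ℝ, 0 < p₁ ≤ p₀ ≤ ∞ and
0 < q₀ = q₁ ≤ ∞.  Then the natural embedding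
  ℓ^{q₀}((2^{j(s−n/p₀)}·ℓ^{p₀}{1,…,2^{nj}})_{j≥A}) ↪ ℓ^{q₁}((2^{j(s−n/p₁)}·ℓ^{p₁}{1,…,2^{nj}})_{j≥A})
is not strictly singular.

The spaces are modelled by reindexing `j ↦ A + j`: the coordinate of index
`j : ℕ` carries the block `ℝ^{2^{n(A+j)}}`, with the convention `n/∞ = 0`.
-/

open scoped ENNReal

namespace Stmt12

/-- The `ℓ^q`-norm of a family of extended-nonnegative numbers. -/
noncomputable def eSeqNorm {ι : Type*} (q : ℝ≥0∞) (f : ι → ℝ≥0∞) : ℝ≥0∞ :=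
  if q = ∞ then ⨆ i, f i else (∑' i, f i ^ q.toReal) ^ (1 / q.toReal)

/-- The scalar `ℓ^p`-(quasi-)norm of a real sequence. -/
noncomputable def elpNorm {ι : Type*} (p : ℝ≥0∞) (a : ι → ℝ) : ℝ≥0∞ :=
  eSeqNorm p fun i => ENNReal.ofReal |a i|

/-- The norm of `ℓ^q((2^{j(s−n/p)}·ℓ^p{1,…,2^{nj}})_{j≥A})` (reindexed by
`j ↦ A + j`), with the convention `n/∞ = 0`. -/
noncomputable def besovBlockNorm (n A : ℕ) (s : ℝ) (p q : ℝ≥0∞)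
    (x : ∀ j : ℕ, Fin (2 ^ (n * (A + j))) → ℝ) : ℝ≥0∞ :=
  eSeqNorm q fun j : ℕ =>
    (2 : ℝ≥0∞) ^ (((A + j : ℕ) : ℝ) * (s - n * p.toReal⁻¹)) * elpNorm p (x j)

/-- `T` is strictly singular w.r.t. the (extended-valued) norms `M₀`, `M₁`. -/
def StrictlySingular {V₀ V₁ : Type*} [AddCommGroup V₀] [Module ℝ V₀]
    [AddCommGroup V₁] [Module ℝ V₁]
    (M₀ : V₀ → ℝ≥0∞) (M₁ : V₁ → ℝ≥0∞) (T : V₀ →ₗ[ℝ] V₁) : Prop :=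
  ∀ Z : Submodule ℝ V₀, (∀ x ∈ Z, M₀ x ≠ ∞) → ¬ FiniteDimensional ℝ Z →
    ∀ ε : ℝ, 0 < ε → ∃ x ∈ Z, M₀ x = 1 ∧ M₁ (T x) < ENNReal.ofReal ε

theorem elpNorm_const {ι : Type*} [Fintype ι] [Nonempty ι] {p : ℝ≥0∞} (hp : p ≠ 0) (c : ℝ) :
    elpNorm p (fun _ : ι => c) =
      (Fintype.card ι : ℝ≥0∞) ^ p.toReal⁻¹ * ENNReal.ofReal |c| := by
  unfold elpNorm eSeqNorm
  split_ifs with h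
  · simp [h]
  · have hpos : 0 < p.toReal := ENNReal.toReal_pos hp h
    rw [tsum_fintype, Finset.sum_const, Finset.card_univ, nsmul_eq_mul, one_div,
      ENNReal.mul_rpow_of_nonneg _ _ (inv_nonneg.2 hpos.le), ENNReal.rpow_rpow_inv hpos.ne']

theorem besovBlockNorm_const (n A : ℕ) (s : ℝ) {p : ℝ≥0∞} (hp : p ≠ 0) (q : ℝ≥0∞)
    (c : ℕ → ℝ) :
    besovBlockNorm n A s p q (fun j _ => c j) =
      eSeqNorm q fun j => (2 : ℝ≥0∞) ^ (((A + j : ℕ) : ℝ) * s) * ENNReal.ofReal |c j| := by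
  unfold besovBlockNorm
  congr 1
  funext j
  rw [elpNorm_const hp, ← mul_assoc, Fintype.card_fin, Nat.cast_pow, Nat.cast_ofNat,
    ← ENNReal.rpow_natCast, ← ENNReal.rpow_mul,
    ← ENNReal.rpow_add _ _ two_ne_zero ENNReal.ofNat_ne_top]
  congr 2
  push_cast
  ring

theorem eSeqNorm_ne_top {ι : Type*} {q : ℝ≥0∞} (hq : q ≠ 0) {f : ι → ℝ≥0∞}
    (hf : ∀ i, f i ≠ ∞) (t : Finset ι) (ht : ∀ i ∉ t, f i = 0) : eSeqNorm q f ≠ ∞ := by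
  unfold eSeqNorm
  split_ifs with h
  · have hle : ⨆ i, f i ≤ ∑ i ∈ t, f i := by
      refine iSup_le fun i => ?_
      by_cases hi : i ∈ t
      · exact Finset.single_le_sum (fun _ _ => zero_le) hi
      · simp [ht i hi]
    exact ne_top_of_le_ne_top (ENNReal.sum_ne_top.2 fun i _ => hf i) hle
  · have hpos : 0 < q.toReal := ENNReal.toReal_pos hq h
    refine ENNReal.rpow_ne_top_of_nonneg (by positivity) ?_
    rw [tsum_eq_sum (s := t) fun i hi => by rw [ht i hi, ENNReal.zero_rpow_of_pos hpos]]
    exact ENNReal.sum_ne_top.2 fun i _ => ENNReal.rpow_ne_top_of_nonneg hpos.le (hf i)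

/-- The finitely supported sequences, embedded as sequences that are constant on each block. -/
def blockConst (κ : ℕ → Type*) : (ℕ →₀ ℝ) →ₗ[ℝ] (∀ j, κ j → ℝ) where
  toFun c := fun j _ => c j
  map_add' _ _ := rfl
  map_smul' _ _ := rfl

theorem blockConst_injective (κ : ℕ → Type*) [∀ j, Nonempty (κ j)] :
    Function.Injective (blockConst κ) := fun _ _ h =>
  Finsupp.ext fun j => congrFun (congrFun h j) (Classical.arbitrary (κ j))

theorem not_finiteDimensional_range_blockConst (κ : ℕ → Type*) [∀ j, Nonempty (κ j)] :
    ¬ FiniteDimensional ℝ (LinearMap.range (blockConst κ)) := fun _ =>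
  have : Module.Finite ℝ (ℕ →₀ ℝ) :=
    Module.Finite.equiv (LinearEquiv.ofInjective _ (blockConst_injective κ)).symm
  not_finite_iff_infinite.2 inferInstance
    (Module.Finite.finite_basis (Finsupp.basisSingleOne (R := ℝ) (ι := ℕ)))

theorem statement12 (n A : ℕ) (hn : 1 ≤ n) (hA : 1 ≤ A) (s : ℝ)
    (p₀ p₁ q₀ q₁ : ℝ≥0∞) (hp₁ : 0 < p₁) (hp : p₁ ≤ p₀)
    (hq₀ : 0 < q₀) (hq : q₀ = q₁) :
    ¬ StrictlySingular (besovBlockNorm n A s p₀ q₀) (besovBlockNorm n A s p₁ q₁)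
      (LinearMap.id : (∀ j : ℕ, Fin (2 ^ (n * (A + j))) → ℝ) →ₗ[ℝ] _) := by
  subst hq
  have hp₀ : p₀ ≠ 0 := (hp₁.trans_le hp).ne'
  intro h
  obtain ⟨_, ⟨c, rfl⟩, h₀, h₁⟩ :=
    h (LinearMap.range (blockConst fun j => Fin (2 ^ (n * (A + j)))))
      (by
        rintro _ ⟨c, rfl⟩
        refine (besovBlockNorm_const n A s hp₀ q₀ c).trans_ne ?_
        refine eSeqNorm_ne_top hq₀.ne' (fun j => ?_) c.support fun j hj => ?_
        · exact ENNReal.mul_ne_top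
            (ENNReal.rpow_ne_top_of_ne_zero two_ne_zero ENNReal.ofNat_ne_top)
            ENNReal.ofReal_ne_top
        · simp [Finsupp.notMem_support_iff.1 hj])
      (not_finiteDimensional_range_blockConst _) 1 one_pos
  have h₀' := (besovBlockNorm_const n A s hp₀ q₀ c).symm.trans h₀
  have h₁' := (besovBlockNorm_const n A s hp₁.ne' q₀ c).symm.trans_lt h₁
  rw [h₀', ENNReal.ofReal_one] at h₁'
  exact lt_irrefl _ h₁'

end Stmt12
end

section
/- Let n ≥ 1, s_0, s_1 ∈ ℝ and 0 < p_0, p_1, q_0, q_1 ≤ ∞ (with n/∞ interpreted as 0). Then the inclusion ℓ^{q_0}((2^{j(s_0−n/p_0+n/2)}·ℓ^{p_0}(ℤ))_{j≥0}) ⊆ ℓ^{q_1}((2^{j(s_1−n/p_1+n/2)}·ℓ^{p_1}(ℤ))_{j≥0}) holds if and only if either (s_0−s_1 = n/p_0−n/p_1 ≥ 0 and q_0 ≤ q_1) or (s_0−s_1 > n/p_0−n/p_1 ≥ 0). Moreover, whenever the inclusion holds, the corresponding embedding is bounded but non-compact. -/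
/-!
STATEMENT 15: For n ≥ 1, s₀, s₁ ∈ ℝ, 0 < p₀, p₁, q₀, q₁ ≤ ∞ (with n/∞ = 0),
the inclusion
  ℓ^{q₀}((2^{j(s₀−n/p₀+n/2)}·ℓ^{p₀}(ℤ))_{j≥0}) ⊆ ℓ^{q₁}((2^{j(s₁−n/p₁+n/2)}·ℓ^{p₁}(ℤ))_{j≥0})
holds iff (s₀−s₁ = n/p₀−n/p₁ ≥ 0 and q₀ ≤ q₁) or (s₀−s₁ > n/p₀−n/p₁ ≥ 0);
and whenever the inclusion holds, the embedding is bounded but non-compact.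
-/

open scoped ENNReal

namespace Stmt15

/-- The `ℓ^q`-norm of a family of extended-nonnegative numbers. -/
noncomputable def eSeqNorm {ι : Type*} (q : ℝ≥0∞) (f : ι → ℝ≥0∞) : ℝ≥0∞ :=
  if q = ∞ then ⨆ i, f i else (∑' i, f i ^ q.toReal) ^ (1 / q.toReal)

/-- The scalar `ℓ^p`-(quasi-)norm of a real sequence. -/
noncomputable def elpNorm {ι : Type*} (p : ℝ≥0∞) (a : ι → ℝ) : ℝ≥0∞ :=
  eSeqNorm p fun i => ENNReal.ofReal |a i|

/-- The norm of the Besov sequence space `ℓ^q((2^{j(s−n/p+n/2)}·ℓ^p(ℤ))_{j≥0})`,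
with the convention `n/∞ = 0`. -/
noncomputable def besovNormZ (n : ℕ) (s : ℝ) (p q : ℝ≥0∞) (x : ℕ → ℤ → ℝ) : ℝ≥0∞ :=
  eSeqNorm q fun j : ℕ =>
    (2 : ℝ≥0∞) ^ ((j : ℝ) * (s - n * p.toReal⁻¹ + n / 2)) * elpNorm p (x j)

/-- The (linear) map `T` is compact w.r.t. the norms `M₀`, `M₁`: the image of
the unit ball is totally bounded. -/
def NormCompact {V₀ V₁ : Type*} [AddCommGroup V₀] [Module ℝ V₀]
    [AddCommGroup V₁] [Module ℝ V₁]
    (M₀ : V₀ → ℝ≥0∞) (M₁ : V₁ → ℝ≥0∞) (T : V₀ →ₗ[ℝ] V₁) : Prop :=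
  ∀ ε : ℝ, 0 < ε → ∃ F : Finset V₁, ∀ x : V₀, M₀ x ≤ 1 →
    ∃ y ∈ F, M₁ (T x - y) < ENNReal.ofReal ε

section SeqNorm

variable {ι κ : Type*} {q q₀ q₁ : ℝ≥0∞} {f g : ι → ℝ≥0∞}

lemma eSeqNorm_top (f : ι → ℝ≥0∞) : eSeqNorm ∞ f = ⨆ i, f i := if_pos rfl

lemma eSeqNorm_of_ne_top (hq : q ≠ ∞) (f : ι → ℝ≥0∞) :
    eSeqNorm q f = (∑' i, f i ^ q.toReal) ^ (1 / q.toReal) := if_neg hq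

lemma eSeqNorm_rpow (hq₀ : 0 < q) (hq : q ≠ ∞) (f : ι → ℝ≥0∞) :
    eSeqNorm q f ^ q.toReal = ∑' i, f i ^ q.toReal := by
  rw [eSeqNorm_of_ne_top hq, ← ENNReal.rpow_mul,
    one_div_mul_cancel (ENNReal.toReal_pos hq₀.ne' hq).ne', ENNReal.rpow_one]

lemma eSeqNorm_eq_top_iff (hq₀ : 0 < q) (hq : q ≠ ∞) :
    eSeqNorm q f = ∞ ↔ ∑' i, f i ^ q.toReal = ∞ := by
  rw [← eSeqNorm_rpow hq₀ hq, ENNReal.rpow_eq_top_iff_of_pos (ENNReal.toReal_pos hq₀.ne' hq)]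

lemma apply_le_eSeqNorm (hq : 0 < q) (f : ι → ℝ≥0∞) (i : ι) : f i ≤ eSeqNorm q f := by
  by_cases h : q = ∞
  · subst h
    exact (le_iSup f i).trans_eq (eSeqNorm_top f).symm
  · rw [← ENNReal.rpow_le_rpow_iff (ENNReal.toReal_pos hq.ne' h), eSeqNorm_rpow hq h]
    exact ENNReal.le_tsum i

lemma eSeqNorm_mono (h : ∀ i, f i ≤ g i) : eSeqNorm q f ≤ eSeqNorm q g := by
  unfold eSeqNorm
  split_ifs
  · exact iSup_mono h
  · gcongr with i
    exact h i

lemma eSeqNorm_mul_const (hq : 0 < q) (f : ι → ℝ≥0∞) (c : ℝ≥0∞) :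
    eSeqNorm q (fun i => f i * c) = eSeqNorm q f * c := by
  by_cases h : q = ∞
  · subst h
    simp only [eSeqNorm_top, ENNReal.iSup_mul]
  · have hr := ENNReal.toReal_pos hq.ne' h
    simp only [eSeqNorm_of_ne_top h, ENNReal.mul_rpow_of_nonneg _ _ hr.le, ENNReal.tsum_mul_right]
    rw [ENNReal.mul_rpow_of_nonneg _ _ (by positivity), ← ENNReal.rpow_mul,
      mul_one_div_cancel hr.ne', ENNReal.rpow_one]

lemma eSeqNorm_comp_equiv (e : κ ≃ ι) (f : ι → ℝ≥0∞) :
    eSeqNorm q (fun k => f (e k)) = eSeqNorm q f := by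
  unfold eSeqNorm
  rw [e.iSup_comp (g := f), e.tsum_eq (fun i => f i ^ q.toReal)]

lemma eSeqNorm_eq_apply (hq : 0 < q) (i : ι) (h : ∀ j, j ≠ i → f j = 0) :
    eSeqNorm q f = f i := by
  refine le_antisymm ?_ (apply_le_eSeqNorm hq f i)
  by_cases hq' : q = ∞
  · subst hq'
    rw [eSeqNorm_top]
    refine iSup_le fun j => ?_
    by_cases hj : j = i
    · rw [hj]
    · simp [h j hj]
  · have hr := ENNReal.toReal_pos hq.ne' hq'
    rw [← ENNReal.rpow_le_rpow_iff hr, eSeqNorm_rpow hq hq', tsum_eq_single i]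
    intro j hj
    rw [h j hj, ENNReal.zero_rpow_of_pos hr]

lemma eSeqNorm_zero (hq : 0 < q) : eSeqNorm q (fun _ : ι => 0) = 0 := by
  simpa using eSeqNorm_mul_const hq (fun _ : ι => 0) 0

lemma eSeqNorm_antitone (hq₀ : 0 < q₀) (h : q₀ ≤ q₁) (f : ι → ℝ≥0∞) :
    eSeqNorm q₁ f ≤ eSeqNorm q₀ f := by
  by_cases h₁ : q₁ = ∞
  · subst h₁
    rw [eSeqNorm_top]
    exact iSup_le (apply_le_eSeqNorm hq₀ f)
  · have h₀ : q₀ ≠ ∞ := ne_top_of_le_ne_top h₁ h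
    have hq₁ : 0 < q₁ := hq₀.trans_le h
    have hr₀ := ENNReal.toReal_pos hq₀.ne' h₀
    have hr : 0 ≤ q₁.toReal - q₀.toReal := sub_nonneg.2 (ENNReal.toReal_mono h₁ h)
    rw [← ENNReal.rpow_le_rpow_iff (ENNReal.toReal_pos hq₁.ne' h₁), eSeqNorm_rpow hq₁ h₁]
    have split (a : ℝ≥0∞) :
        a ^ q₁.toReal = a ^ (q₁.toReal - q₀.toReal) * a ^ q₀.toReal := by
      rw [← ENNReal.rpow_add_of_nonneg _ _ hr hr₀.le, sub_add_cancel]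
    rw [split (eSeqNorm q₀ f), eSeqNorm_rpow hq₀ h₀, ← ENNReal.tsum_mul_left]
    gcongr with i
    rw [split (f i)]
    gcongr
    exact apply_le_eSeqNorm hq₀ f i

end SeqNorm

section Examples

variable {q q₀ q₁ : ℝ≥0∞}

lemma eSeqNorm_two_rpow_neg_ne_top (hq : 0 < q) {δ : ℝ} (hδ : 0 < δ) :
    eSeqNorm q (fun j : ℕ => (2 : ℝ≥0∞) ^ ((j : ℝ) * -δ)) ≠ ∞ := by
  by_cases h : q = ∞
  · subst h
    rw [eSeqNorm_top]
    refine ne_top_of_le_ne_top ENNReal.one_ne_top (iSup_le fun j => ?_)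
    have hj : (j : ℝ) * -δ ≤ 0 := by nlinarith [j.cast_nonneg (α := ℝ)]
    simpa using ENNReal.rpow_le_rpow_of_exponent_le (x := 2) one_le_two hj
  · rw [Ne, eSeqNorm_eq_top_iff hq h]
    have hr := ENNReal.toReal_pos hq.ne' h
    have geom (j : ℕ) : ((2 : ℝ≥0∞) ^ ((j : ℝ) * -δ)) ^ q.toReal
        = ((2 : ℝ≥0∞) ^ (-(δ * q.toReal))) ^ j := by
      rw [← ENNReal.rpow_mul, ← ENNReal.rpow_natCast, ← ENNReal.rpow_mul]
      ring_nf
    simp only [geom, ENNReal.tsum_geometric]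
    rw [ENNReal.inv_eq_top, tsub_eq_zero_iff_le, not_le]
    exact ENNReal.rpow_lt_one_of_one_lt_of_neg (by norm_num) (by simpa using mul_pos hδ hr)

lemma eSeqNorm_two_rpow_eq_top (hq : 0 < q) {δ : ℝ} (hδ : 0 < δ) :
    eSeqNorm q (fun j : ℕ => (2 : ℝ≥0∞) ^ ((j : ℝ) * δ)) = ∞ := by
  refine top_unique ?_
  have growth (j : ℕ) : ((2 : ℝ≥0∞) ^ δ) ^ j
      ≤ eSeqNorm q (fun j : ℕ => (2 : ℝ≥0∞) ^ ((j : ℝ) * δ)) := by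
    rw [← ENNReal.rpow_natCast, ← ENNReal.rpow_mul, mul_comm]
    exact apply_le_eSeqNorm hq (fun j : ℕ => (2 : ℝ≥0∞) ^ ((j : ℝ) * δ)) j
  have htop := ENNReal.tendsto_pow_atTop_nhds_top_iff.2
    (ENNReal.one_lt_rpow (x := 2) (by norm_num) hδ)
  exact le_of_tendsto' htop growth

lemma exists_elpNorm_ne_top_and_eq_top (hq₁ : 0 < q₁) (h : q₁ < q₀) :
    ∃ c : ℕ → ℝ, elpNorm q₀ c ≠ ∞ ∧ elpNorm q₁ c = ∞ := by
  have h₁ : q₁ ≠ ∞ := h.ne_top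
  have hr₁ := ENNReal.toReal_pos hq₁.ne' h₁
  have power (r : ℝ) (hr : 0 ≤ r) (j : ℕ) :
      ENNReal.ofReal |((j + 1 : ℕ) : ℝ) ^ (-(1 / q₁.toReal))| ^ r
        = ENNReal.ofReal (((j + 1 : ℕ) : ℝ) ^ (-(r / q₁.toReal))) := by
    rw [abs_of_nonneg (by positivity), ENNReal.ofReal_rpow_of_nonneg (by positivity) hr,
      ← Real.rpow_mul (by positivity)]
    ring_nf
  refine ⟨fun j => ((j + 1 : ℕ) : ℝ) ^ (-(1 / q₁.toReal)), ?_, ?_⟩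
  · by_cases h₀ : q₀ = ∞
    · subst h₀
      rw [elpNorm, eSeqNorm_top]
      refine ne_top_of_le_ne_top ENNReal.one_ne_top (iSup_le fun j => ?_)
      rw [ENNReal.ofReal_le_one, abs_of_nonneg (by positivity)]
      exact Real.rpow_le_one_of_one_le_of_nonpos (by simp) (by simp)
    · have hr : q₁.toReal < q₀.toReal := ENNReal.toReal_strict_mono h₀ h
      rw [elpNorm, Ne, eSeqNorm_eq_top_iff (hq₁.trans h) h₀]
      simp only [power _ (hr₁.trans hr).le]
      refine Summable.tsum_ofReal_ne_top
        ((summable_nat_add_iff (f := fun j : ℕ => (j : ℝ) ^ (-(q₀.toReal / q₁.toReal))) 1).2 ?_)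
      rw [Real.summable_nat_rpow, neg_lt_neg_iff, one_lt_div hr₁]
      exact hr
  · rw [elpNorm, eSeqNorm_eq_top_iff hq₁ h₁]
    simp only [power _ hr₁.le]
    by_contra hfin
    have hsum := ENNReal.summable_toReal hfin
    simp only [ENNReal.toReal_ofReal (Real.rpow_nonneg (Nat.cast_nonneg _) _)] at hsum
    rw [summable_nat_add_iff (f := fun j : ℕ => (j : ℝ) ^ (-(q₁.toReal / q₁.toReal))) 1,
      Real.summable_nat_rpow, div_self hr₁.ne'] at hsum
    exact lt_irrefl _ hsum

end Examples

section Besov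

variable {n : ℕ} {s s₀ s₁ : ℝ} {p p₀ p₁ q q₀ q₁ : ℝ≥0∞}

lemma elpNorm_single (hp : 0 < p) {ι : Type*} [DecidableEq ι] (i : ι) (a : ℝ) :
    elpNorm p (Pi.single i a) = ENNReal.ofReal |a| := by
  rw [elpNorm, eSeqNorm_eq_apply hp i]
  · simp
  · intro j hj
    simp [hj]

lemma elpNorm_zero (hp : 0 < p) {ι : Type*} : elpNorm p (0 : ι → ℝ) = 0 := by
  simpa [elpNorm] using eSeqNorm_zero (ι := ι) hp

lemma besovNormZ_single_zero (hp : 0 < p) (hq : 0 < q) (a : ℤ → ℝ) :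
    besovNormZ n s p q (Pi.single 0 a) = elpNorm p a := by
  rw [besovNormZ, eSeqNorm_eq_apply hq 0]
  · simp
  · intro j hj
    simp [hj, elpNorm_zero hp]

lemma besovNormZ_const_single (hp : 0 < p) (b : ℕ → ℝ) :
    besovNormZ n s p q (fun j => Pi.single 0 (b j))
      = eSeqNorm q fun j : ℕ =>
        (2 : ℝ≥0∞) ^ ((j : ℝ) * (s - n * p.toReal⁻¹ + n / 2)) * ENNReal.ofReal |b j| := by
  simp only [besovNormZ, elpNorm_single hp]

lemma besovNormZ_two_rpow_mul_single (hp : 0 < p) (σ : ℝ) (c : ℕ → ℝ) :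
    besovNormZ n s p q (fun j => Pi.single 0 ((2 : ℝ) ^ ((j : ℝ) * -σ) * c j))
      = eSeqNorm q fun j : ℕ =>
        (2 : ℝ≥0∞) ^ ((j : ℝ) * (s - n * p.toReal⁻¹ + n / 2 - σ)) * ENNReal.ofReal |c j| := by
  rw [besovNormZ_const_single hp]
  congr 1
  funext j
  rw [abs_mul, ENNReal.ofReal_mul (abs_nonneg _), abs_of_nonneg (by positivity),
    ← ENNReal.ofReal_rpow_of_pos two_pos, ENNReal.ofReal_ofNat, ← mul_assoc,
    ← ENNReal.rpow_add _ _ two_ne_zero ENNReal.ofNat_ne_top]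
  ring_nf

lemma apply_le_besovNormZ_zero (hp : 0 < p) (hq : 0 < q) (x : ℕ → ℤ → ℝ) (k : ℤ) :
    ENNReal.ofReal |x 0 k| ≤ besovNormZ n s p q x := by
  refine (apply_le_eSeqNorm hp (fun k => ENNReal.ofReal |x 0 k|) k).trans ?_
  refine le_trans ?_ (apply_le_eSeqNorm hq (fun j : ℕ =>
    (2 : ℝ≥0∞) ^ ((j : ℝ) * (s - n * p.toReal⁻¹ + n / 2)) * elpNorm p (x j)) 0)
  simp [elpNorm]

lemma toReal_inv_anti (hp₀ : 0 < p₀) (h : p₀ ≤ p₁) : p₁.toReal⁻¹ ≤ p₀.toReal⁻¹ := by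
  rw [← ENNReal.toReal_inv, ← ENNReal.toReal_inv]
  exact ENNReal.toReal_mono (ENNReal.inv_ne_top.2 hp₀.ne') (ENNReal.inv_le_inv.2 h)

lemma le_of_toReal_inv_le (hp₀ : 0 < p₀) (hp₁ : 0 < p₁) (h : p₁.toReal⁻¹ ≤ p₀.toReal⁻¹) :
    p₀ ≤ p₁ := by
  rw [← ENNReal.toReal_inv, ← ENNReal.toReal_inv] at h
  rwa [ENNReal.toReal_le_toReal (ENNReal.inv_ne_top.2 hp₁.ne') (ENNReal.inv_ne_top.2 hp₀.ne'),
    ENNReal.inv_le_inv] at h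

lemma integrability_le_of_inclusion (hp₀ : 0 < p₀) (hp₁ : 0 < p₁) (hq₀ : 0 < q₀) (hq₁ : 0 < q₁)
    (h : ∀ x, besovNormZ n s₀ p₀ q₀ x ≠ ∞ → besovNormZ n s₁ p₁ q₁ x ≠ ∞) : p₀ ≤ p₁ := by
  by_contra! hlt
  obtain ⟨c, hc₀, hc₁⟩ := exists_elpNorm_ne_top_and_eq_top hp₁ hlt
  have reindex (p : ℝ≥0∞) : elpNorm p (fun k => c (Equiv.intEquivNat k)) = elpNorm p c :=
    eSeqNorm_comp_equiv Equiv.intEquivNat fun j => ENNReal.ofReal |c j|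
  refine h (Pi.single 0 fun k => c (Equiv.intEquivNat k)) ?_ ?_
  · rwa [besovNormZ_single_zero hp₀ hq₀, reindex]
  · rwa [besovNormZ_single_zero hp₁ hq₁, reindex]

lemma smoothness_le_of_inclusion (hp₀ : 0 < p₀) (hp₁ : 0 < p₁) (hq₀ : 0 < q₀) (hq₁ : 0 < q₁)
    (h : ∀ x, besovNormZ n s₀ p₀ q₀ x ≠ ∞ → besovNormZ n s₁ p₁ q₁ x ≠ ∞) :
    s₁ - n * p₁.toReal⁻¹ ≤ s₀ - n * p₀.toReal⁻¹ := by
  by_contra! hlt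
  set δ := (s₁ - n * p₁.toReal⁻¹ - (s₀ - n * p₀.toReal⁻¹)) / 2 with hδ
  have hδ₀ : 0 < δ := by linarith
  refine h (fun j => Pi.single 0
    ((2 : ℝ) ^ ((j : ℝ) * -(s₀ - n * p₀.toReal⁻¹ + n / 2 + δ)) * 1)) ?_ ?_
  · rw [besovNormZ_two_rpow_mul_single hp₀]
    convert eSeqNorm_two_rpow_neg_ne_top hq₀ hδ₀ using 3 with j
    simp
  · rw [besovNormZ_two_rpow_mul_single hp₁]
    convert eSeqNorm_two_rpow_eq_top hq₁ hδ₀ using 2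
    funext j
    rw [abs_one, ENNReal.ofReal_one, mul_one, hδ]
    ring_nf

lemma summability_le_of_inclusion (hp₀ : 0 < p₀) (hp₁ : 0 < p₁) (hq₁ : 0 < q₁)
    (h : ∀ x, besovNormZ n s₀ p₀ q₀ x ≠ ∞ → besovNormZ n s₁ p₁ q₁ x ≠ ∞)
    (hs : s₀ - s₁ = n * p₀.toReal⁻¹ - n * p₁.toReal⁻¹) : q₀ ≤ q₁ := by
  by_contra! hlt
  obtain ⟨c, hc₀, hc₁⟩ := exists_elpNorm_ne_top_and_eq_top hq₁ hlt
  have hs' : s₁ - n * p₁.toReal⁻¹ + n / 2 - (s₀ - n * p₀.toReal⁻¹ + n / 2) = 0 := by linarith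
  refine h (fun j => Pi.single 0
    ((2 : ℝ) ^ ((j : ℝ) * -(s₀ - n * p₀.toReal⁻¹ + n / 2)) * c j)) ?_ ?_
  · rw [besovNormZ_two_rpow_mul_single hp₀]
    simpa [elpNorm] using hc₀
  · rw [besovNormZ_two_rpow_mul_single hp₁]
    simpa [elpNorm, hs'] using hc₁

lemma besovNormZ_le_of_critical (hp₀ : 0 < p₀) (hq₀ : 0 < q₀) (hp : p₀ ≤ p₁) (hq : q₀ ≤ q₁)
    (hs : s₀ - s₁ = n * p₀.toReal⁻¹ - n * p₁.toReal⁻¹) (x : ℕ → ℤ → ℝ) :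
    besovNormZ n s₁ p₁ q₁ x ≤ besovNormZ n s₀ p₀ q₀ x := by
  have hs' : s₁ - n * p₁.toReal⁻¹ = s₀ - n * p₀.toReal⁻¹ := by linarith
  refine (eSeqNorm_antitone hq₀ hq _).trans (eSeqNorm_mono fun j => ?_)
  rw [hs']
  gcongr
  exact eSeqNorm_antitone hp₀ hp _

lemma besovNormZ_le_of_subcritical (hp₀ : 0 < p₀) (hq₀ : 0 < q₀) (hq₁ : 0 < q₁) (hp : p₀ ≤ p₁)
    (x : ℕ → ℤ → ℝ) :
    besovNormZ n s₁ p₁ q₁ x ≤ eSeqNorm q₁ (fun j : ℕ => (2 : ℝ≥0∞) ^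
      ((j : ℝ) * -(s₀ - n * p₀.toReal⁻¹ - (s₁ - n * p₁.toReal⁻¹)))) *
        besovNormZ n s₀ p₀ q₀ x := by
  rw [← eSeqNorm_mul_const hq₁]
  refine eSeqNorm_mono fun j => ?_
  calc
    _ ≤ (2 : ℝ≥0∞) ^ ((j : ℝ) * (s₁ - n * p₁.toReal⁻¹ + n / 2)) * elpNorm p₀ (x j) := by
      gcongr
      exact eSeqNorm_antitone hp₀ hp _
    _ = (2 : ℝ≥0∞) ^ ((j : ℝ) * -(s₀ - n * p₀.toReal⁻¹ - (s₁ - n * p₁.toReal⁻¹))) *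
        ((2 : ℝ≥0∞) ^ ((j : ℝ) * (s₀ - n * p₀.toReal⁻¹ + n / 2)) * elpNorm p₀ (x j)) := by
      rw [← mul_assoc, ← ENNReal.rpow_add _ _ two_ne_zero ENNReal.ofNat_ne_top]
      ring_nf
    _ ≤ _ := by
      gcongr
      exact apply_le_eSeqNorm hq₀ (fun j : ℕ =>
        (2 : ℝ≥0∞) ^ ((j : ℝ) * (s₀ - n * p₀.toReal⁻¹ + n / 2)) * elpNorm p₀ (x j)) j

lemma not_normCompact_id (hp₀ : 0 < p₀) (hp₁ : 0 < p₁) (hq₀ : 0 < q₀) (hq₁ : 0 < q₁) :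
    ¬ NormCompact (besovNormZ n s₀ p₀ q₀) (besovNormZ n s₁ p₁ q₁)
      (LinearMap.id : (ℕ → ℤ → ℝ) →ₗ[ℝ] (ℕ → ℤ → ℝ)) := by
  intro hcomp
  obtain ⟨F, hF⟩ := hcomp (1 / 2) (by norm_num)
  let e : ℤ → ℕ → ℤ → ℝ := fun k => Pi.single 0 (Pi.single k 1)
  have he (k : ℤ) : besovNormZ n s₀ p₀ q₀ (e k) ≤ 1 := by
    rw [besovNormZ_single_zero hp₀ hq₀, elpNorm_single hp₀]
    simp
  choose y hyF hy using fun k => hF (e k) (he k)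
  have close (k i : ℤ) : |e k 0 i - y k 0 i| < 1 / 2 :=
    (ENNReal.ofReal_lt_ofReal_iff (by norm_num)).1
      ((apply_le_besovNormZ_zero hp₁ hq₁ (e k - y k) i).trans_lt (hy k))
  obtain ⟨k, l, hkl, hykl⟩ :=
    Finite.exists_ne_map_eq_of_infinite fun k => (⟨y k, hyF k⟩ : F)
  have hyeq : y k = y l := congrArg Subtype.val hykl
  have hk := close k k
  have hl := close l k
  rw [← hyeq] at hl
  simp only [e, Pi.single_eq_same, Pi.single_eq_of_ne hkl] at hk hl
  linarith [(abs_lt.1 hk).2, (abs_lt.1 hl).1]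

end Besov

theorem statement15 (n : ℕ) (hn : 1 ≤ n) (s₀ s₁ : ℝ) (p₀ p₁ q₀ q₁ : ℝ≥0∞)
    (hp₀ : 0 < p₀) (hp₁ : 0 < p₁) (hq₀ : 0 < q₀) (hq₁ : 0 < q₁) :
    ((∀ x : ℕ → ℤ → ℝ, besovNormZ n s₀ p₀ q₀ x ≠ ∞ → besovNormZ n s₁ p₁ q₁ x ≠ ∞)
      ↔ ((s₀ - s₁ = n * p₀.toReal⁻¹ - n * p₁.toReal⁻¹
            ∧ 0 ≤ (n : ℝ) * p₀.toReal⁻¹ - n * p₁.toReal⁻¹ ∧ q₀ ≤ q₁)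
          ∨ (s₀ - s₁ > n * p₀.toReal⁻¹ - n * p₁.toReal⁻¹
            ∧ 0 ≤ (n : ℝ) * p₀.toReal⁻¹ - n * p₁.toReal⁻¹)))
    ∧ ((∀ x : ℕ → ℤ → ℝ, besovNormZ n s₀ p₀ q₀ x ≠ ∞ → besovNormZ n s₁ p₁ q₁ x ≠ ∞) →
        (∃ C : ℝ≥0∞, C ≠ ∞ ∧ ∀ x : ℕ → ℤ → ℝ,
            besovNormZ n s₁ p₁ q₁ x ≤ C * besovNormZ n s₀ p₀ q₀ x)
        ∧ ¬ NormCompact (besovNormZ n s₀ p₀ q₀) (besovNormZ n s₁ p₁ q₁)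
            (LinearMap.id : (ℕ → ℤ → ℝ) →ₗ[ℝ] (ℕ → ℤ → ℝ))) := by
  have hn₀ : (0 : ℝ) < n := by exact_mod_cast hn
  have hp_iff : 0 ≤ (n : ℝ) * p₀.toReal⁻¹ - n * p₁.toReal⁻¹ ↔ p₀ ≤ p₁ := by
    rw [sub_nonneg, mul_le_mul_iff_right₀ hn₀]
    exact ⟨le_of_toReal_inv_le hp₀ hp₁, toReal_inv_anti hp₀⟩
  rw [hp_iff]
  have necessary (h : ∀ x : ℕ → ℤ → ℝ,
      besovNormZ n s₀ p₀ q₀ x ≠ ∞ → besovNormZ n s₁ p₁ q₁ x ≠ ∞) :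
      (s₀ - s₁ = n * p₀.toReal⁻¹ - n * p₁.toReal⁻¹ ∧ p₀ ≤ p₁ ∧ q₀ ≤ q₁) ∨
        (s₀ - s₁ > n * p₀.toReal⁻¹ - n * p₁.toReal⁻¹ ∧ p₀ ≤ p₁) := by
    have hp := integrability_le_of_inclusion hp₀ hp₁ hq₀ hq₁ h
    have hs := smoothness_le_of_inclusion hp₀ hp₁ hq₀ hq₁ h
    rcases eq_or_lt_of_le
      (show n * p₀.toReal⁻¹ - n * p₁.toReal⁻¹ ≤ s₀ - s₁ by linarith) with heq | hlt
    · exact .inl ⟨heq.symm, hp, summability_le_of_inclusion hp₀ hp₁ hq₁ h heq.symm⟩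
    · exact .inr ⟨hlt, hp⟩
  have bounded (h : (s₀ - s₁ = n * p₀.toReal⁻¹ - n * p₁.toReal⁻¹ ∧ p₀ ≤ p₁ ∧ q₀ ≤ q₁) ∨
      (s₀ - s₁ > n * p₀.toReal⁻¹ - n * p₁.toReal⁻¹ ∧ p₀ ≤ p₁)) :
      ∃ C : ℝ≥0∞, C ≠ ∞ ∧ ∀ x : ℕ → ℤ → ℝ,
        besovNormZ n s₁ p₁ q₁ x ≤ C * besovNormZ n s₀ p₀ q₀ x := by
    rcases h with ⟨hs, hp, hq⟩ | ⟨hs, hp⟩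
    · exact ⟨1, ENNReal.one_ne_top, fun x =>
        (besovNormZ_le_of_critical hp₀ hq₀ hp hq hs x).trans_eq (one_mul _).symm⟩
    · exact ⟨_, eSeqNorm_two_rpow_neg_ne_top hq₁ (by linarith),
        besovNormZ_le_of_subcritical hp₀ hq₀ hq₁ hp⟩
  refine ⟨⟨necessary, fun h x hx => ?_⟩, fun h =>
    ⟨bounded (necessary h), not_normCompact_id hp₀ hp₁ hq₀ hq₁⟩⟩
  obtain ⟨C, hC, hle⟩ := bounded h
  exact ne_top_of_le_ne_top (ENNReal.mul_ne_top hC hx) (hle x)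

end Stmt15
end

section
/- Let n ≥ 1, s_0, s_1 ∈ ℝ and 0 < p_0, p_1, q_0, q_1 ≤ ∞ (with n/∞ interpreted as 0). Then the inclusion ℓ^{q_0}((2^{j(s_0−n/p_0)}·ℓ^{p_0}{1,…,2^{nj}})_{j≥0}) ⊆ ℓ^{q_1}((2^{j(s_1−n/p_1)}·ℓ^{p_1}{1,…,2^{nj}})_{j≥0}) holds if and only if either (s_0−s_1 = max(0, n/p_0−n/p_1) and q_0 ≤ q_1) or s_0−s_1 > max(0, n/p_0−n/p_1). Moreover, whenever the inclusion holds, the corresponding embedding is compact if and only if s_0−s_1 > max(0, n/p_0−n/p_1). -/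
/-!
STATEMENT 16: For n ≥ 1, s₀, s₁ ∈ ℝ, 0 < p₀, p₁, q₀, q₁ ≤ ∞ (with n/∞ = 0),
the inclusion
  ℓ^{q₀}((2^{j(s₀−n/p₀)}·ℓ^{p₀}{1,…,2^{nj}})_{j≥0}) ⊆ ℓ^{q₁}((2^{j(s₁−n/p₁)}·ℓ^{p₁}{1,…,2^{nj}})_{j≥0})
holds iff (s₀−s₁ = max(0, n/p₀−n/p₁) and q₀ ≤ q₁) or s₀−s₁ > max(0, n/p₀−n/p₁);
and whenever the inclusion holds, the embedding is compact iff
s₀−s₁ > max(0, n/p₀−n/p₁).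
-/

open scoped ENNReal

namespace Stmt16

/-- The `ℓ^q`-norm of a family of extended-nonnegative numbers. -/
noncomputable def eSeqNorm {ι : Type*} (q : ℝ≥0∞) (f : ι → ℝ≥0∞) : ℝ≥0∞ :=
  if q = ∞ then ⨆ i, f i else (∑' i, f i ^ q.toReal) ^ (1 / q.toReal)

/-- The scalar `ℓ^p`-(quasi-)norm of a real sequence. -/
noncomputable def elpNorm {ι : Type*} (p : ℝ≥0∞) (a : ι → ℝ) : ℝ≥0∞ :=
  eSeqNorm p fun i => ENNReal.ofReal |a i|

/-- The norm of the Besov sequence space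
`ℓ^q((2^{j(s−n/p)}·ℓ^p{1,…,2^{nj}})_{j≥0})`, with the convention `n/∞ = 0`. -/
noncomputable def besovNormFin (n : ℕ) (s : ℝ) (p q : ℝ≥0∞)
    (x : ∀ j : ℕ, Fin (2 ^ (n * j)) → ℝ) : ℝ≥0∞ :=
  eSeqNorm q fun j : ℕ =>
    (2 : ℝ≥0∞) ^ ((j : ℝ) * (s - n * p.toReal⁻¹)) * elpNorm p (x j)

/-- The (linear) map `T` is compact w.r.t. the norms `M₀`, `M₁`: the image of
the unit ball is totally bounded. -/
def NormCompact {V₀ V₁ : Type*} [AddCommGroup V₀] [Module ℝ V₀]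
    [AddCommGroup V₁] [Module ℝ V₁]
    (M₀ : V₀ → ℝ≥0∞) (M₁ : V₁ → ℝ≥0∞) (T : V₀ →ₗ[ℝ] V₁) : Prop :=
  ∀ ε : ℝ, 0 < ε → ∃ F : Finset V₁, ∀ x : V₀, M₀ x ≤ 1 →
    ∃ y ∈ F, M₁ (T x - y) < ENNReal.ofReal ε

section SequenceNorm

variable {ι : Type*} {p q : ℝ≥0∞} {f g : ι → ℝ≥0∞}

theorem eSeqNorm_top (f : ι → ℝ≥0∞) : eSeqNorm ∞ f = ⨆ i, f i := if_pos rfl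

theorem eSeqNorm_of_ne_top (hq : q ≠ ∞) (f : ι → ℝ≥0∞) :
    eSeqNorm q f = (∑' i, f i ^ q.toReal) ^ q.toReal⁻¹ := by
  rw [eSeqNorm, if_neg hq, one_div]

theorem eSeqNorm_rpow (hq₀ : 0 < q) (hq : q ≠ ∞) (f : ι → ℝ≥0∞) :
    eSeqNorm q f ^ q.toReal = ∑' i, f i ^ q.toReal := by
  rw [eSeqNorm_of_ne_top hq, ← ENNReal.rpow_mul,
    inv_mul_cancel₀ (ENNReal.toReal_pos hq₀.ne' hq).ne', ENNReal.rpow_one]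

theorem eSeqNorm_le_iff (hq₀ : 0 < q) (hq : q ≠ ∞) {C : ℝ≥0∞} :
    eSeqNorm q f ≤ C ↔ ∑' i, f i ^ q.toReal ≤ C ^ q.toReal := by
  rw [eSeqNorm_of_ne_top hq, ENNReal.rpow_inv_le_iff (ENNReal.toReal_pos hq₀.ne' hq)]

theorem eSeqNorm_mono (h : ∀ i, f i ≤ g i) : eSeqNorm q f ≤ eSeqNorm q g := by
  rcases eq_or_ne q ∞ with rfl | hq
  · simpa only [eSeqNorm_top] using iSup_mono h
  · rw [eSeqNorm_of_ne_top hq, eSeqNorm_of_ne_top hq]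
    gcongr with i
    exact h i

theorem le_eSeqNorm (hq₀ : 0 < q) (f : ι → ℝ≥0∞) (i : ι) : f i ≤ eSeqNorm q f := by
  rcases eq_or_ne q ∞ with rfl | hq
  · rw [eSeqNorm_top]
    exact le_iSup f i
  · rw [← ENNReal.rpow_le_rpow_iff (ENNReal.toReal_pos hq₀.ne' hq), eSeqNorm_rpow hq₀ hq]
    exact ENNReal.le_tsum (f := fun i => f i ^ q.toReal) i

theorem eSeqNorm_const_mul (hq₀ : 0 < q) (c : ℝ≥0∞) (f : ι → ℝ≥0∞) :
    eSeqNorm q (fun i => c * f i) = c * eSeqNorm q f := by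
  rcases eq_or_ne q ∞ with rfl | hq
  · rw [eSeqNorm_top, eSeqNorm_top, ENNReal.mul_iSup]
  · have hpos := ENNReal.toReal_pos hq₀.ne' hq
    rw [eSeqNorm_of_ne_top hq, eSeqNorm_of_ne_top hq]
    simp_rw [ENNReal.mul_rpow_of_nonneg _ _ hpos.le]
    rw [ENNReal.tsum_mul_left, ENNReal.mul_rpow_of_nonneg _ _ (inv_nonneg.2 hpos.le),
      ← ENNReal.rpow_mul, mul_inv_cancel₀ hpos.ne', ENNReal.rpow_one]

theorem eSeqNorm_le_of_le (hp₀ : 0 < p) (hpq : p ≤ q) (f : ι → ℝ≥0∞) :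
    eSeqNorm q f ≤ eSeqNorm p f := by
  rcases eq_or_ne q ∞ with rfl | hq
  · rw [eSeqNorm_top]
    exact iSup_le (le_eSeqNorm hp₀ f)
  · have hp : p ≠ ∞ := (hpq.trans_lt hq.lt_top).ne
    have hle : p.toReal ≤ q.toReal := ENNReal.toReal_mono hq hpq
    have hsplit : ∀ x : ℝ≥0∞, x ^ q.toReal = x ^ (q.toReal - p.toReal) * x ^ p.toReal := by
      intro x
      rw [← ENNReal.rpow_add_of_nonneg _ _ (sub_nonneg.2 hle) ENNReal.toReal_nonneg,
        sub_add_cancel]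
    rw [eSeqNorm_le_iff (hp₀.trans_le hpq) hq, hsplit (eSeqNorm p f), eSeqNorm_rpow hp₀ hp,
      ← ENNReal.tsum_mul_left]
    gcongr with i
    rw [hsplit (f i)]
    gcongr
    exact le_eSeqNorm hp₀ f i

theorem eSeqNorm_const [Fintype ι] [Nonempty ι] (hp₀ : 0 < p) (c : ℝ≥0∞) :
    eSeqNorm p (fun _ : ι => c) = (Fintype.card ι : ℝ≥0∞) ^ p.toReal⁻¹ * c := by
  rcases eq_or_ne p ∞ with rfl | hp
  · simp [eSeqNorm_top]
  · have hpos := ENNReal.toReal_pos hp₀.ne' hp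
    rw [eSeqNorm_of_ne_top hp, tsum_fintype, Finset.sum_const, Finset.card_univ, nsmul_eq_mul,
      ENNReal.mul_rpow_of_nonneg _ _ (inv_nonneg.2 hpos.le), ← ENNReal.rpow_mul,
      mul_inv_cancel₀ hpos.ne', ENNReal.rpow_one]

theorem eSeqNorm_le_card_rpow_mul [Fintype ι] [Nonempty ι] (hq₀ : 0 < q) (hqp : q ≤ p)
    (f : ι → ℝ≥0∞) :
    eSeqNorm q f ≤ (Fintype.card ι : ℝ≥0∞) ^ (q.toReal⁻¹ - p.toReal⁻¹) * eSeqNorm p f := by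
  have hp₀ : 0 < p := hq₀.trans_le hqp
  rcases eq_or_ne p ∞ with rfl | hp
  · calc eSeqNorm q f ≤ eSeqNorm q (fun _ : ι => eSeqNorm ∞ f) :=
          eSeqNorm_mono (le_eSeqNorm hp₀ f)
      _ = _ := by rw [eSeqNorm_const hq₀]; simp
  · have hq : q ≠ ∞ := (hqp.trans_lt hp.lt_top).ne
    have hpp := ENNReal.toReal_pos hp₀.ne' hp
    have hqq := ENNReal.toReal_pos hq₀.ne' hq
    have hle : q.toReal ≤ p.toReal := ENNReal.toReal_mono hp hqp
    have key := ENNReal.rpow_sum_le_const_mul_sum_rpow Finset.univ (fun i => f i ^ q.toReal)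
      (p := p.toReal / q.toReal) ((one_le_div hqq).2 hle)
    simp_rw [← ENNReal.rpow_mul, mul_div_cancel₀ p.toReal hqq.ne'] at key
    rw [← ENNReal.rpow_le_rpow_iff hpp, ENNReal.mul_rpow_of_nonneg _ _ hpp.le,
      eSeqNorm_rpow hp₀ hp, eSeqNorm_of_ne_top hq, ← ENNReal.rpow_mul, ← ENNReal.rpow_mul,
      tsum_fintype, tsum_fintype]
    convert key using 2
    · field_simp
    · rw [Finset.card_univ]; congr 1; field_simp

theorem eSeqNorm_pi_single [DecidableEq ι] (hp₀ : 0 < p) (i : ι) (c : ℝ≥0∞) :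
    eSeqNorm p (Pi.single i c) = c := by
  refine le_antisymm ?_ ?_
  · rcases eq_or_ne p ∞ with rfl | hp
    · rw [eSeqNorm_top]
      refine iSup_le fun k => ?_
      by_cases hk : k = i
      · subst hk; simp
      · simp [hk]
    · have hpos := ENNReal.toReal_pos hp₀.ne' hp
      rw [eSeqNorm_le_iff hp₀ hp, tsum_eq_single i]
      · simp
      · intro k hk
        simp [hk, hpos]
  · simpa using le_eSeqNorm hp₀ (Pi.single i c) i

theorem eSeqNorm_add_le (hp₀ : 0 < p) (f g : ι → ℝ≥0∞) :
    eSeqNorm p (fun i => f i + g i) ≤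
      2 * 2 ^ p.toReal⁻¹ * max (eSeqNorm p f) (eSeqNorm p g) := by
  have hadd : ∀ x y : ℝ≥0∞, x + y ≤ 2 * max x y := fun x y => by
    rw [two_mul]
    exact add_le_add (le_max_left _ _) (le_max_right _ _)
  rcases eq_or_ne p ∞ with rfl | hp
  · rw [eSeqNorm_top]
    refine iSup_le fun i => (hadd _ _).trans ?_
    simp only [ENNReal.toReal_top, inv_zero, ENNReal.rpow_zero, mul_one]
    gcongr
    · exact le_eSeqNorm hp₀ f i
    · exact le_eSeqNorm hp₀ g i
  · have hpos := ENNReal.toReal_pos hp₀.ne' hp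
    rw [eSeqNorm_le_iff hp₀ hp, ENNReal.mul_rpow_of_nonneg _ _ hpos.le,
      ENNReal.mul_rpow_of_nonneg _ _ hpos.le, ← ENNReal.rpow_mul, inv_mul_cancel₀ hpos.ne',
      ENNReal.rpow_one, (ENNReal.monotone_rpow_of_nonneg hpos.le).map_max, eSeqNorm_rpow hp₀ hp,
      eSeqNorm_rpow hp₀ hp, mul_assoc]
    calc ∑' i, (f i + g i) ^ p.toReal
        ≤ ∑' i, 2 ^ p.toReal * (f i ^ p.toReal + g i ^ p.toReal) := by
          gcongr with i
          calc (f i + g i) ^ p.toReal ≤ (2 * max (f i) (g i)) ^ p.toReal := by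
                gcongr; exact hadd _ _
            _ = 2 ^ p.toReal * max (f i ^ p.toReal) (g i ^ p.toReal) := by
                rw [ENNReal.mul_rpow_of_nonneg _ _ hpos.le,
                  (ENNReal.monotone_rpow_of_nonneg hpos.le).map_max]
            _ ≤ _ := by gcongr; exact max_le le_self_add le_add_self
      _ = 2 ^ p.toReal * (∑' i, f i ^ p.toReal + ∑' i, g i ^ p.toReal) := by
          rw [ENNReal.tsum_mul_left, ENNReal.tsum_add]
      _ ≤ _ := by gcongr; exact hadd _ _

end SequenceNorm

section BlockNorm

variable {ι : Type*} {p : ℝ≥0∞}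

theorem elpNorm_smul (hp₀ : 0 < p) (t : ℝ) (v : ι → ℝ) :
    elpNorm p (t • v) = ENNReal.ofReal |t| * elpNorm p v := by
  rw [elpNorm, elpNorm, ← eSeqNorm_const_mul hp₀]
  simp only [Pi.smul_apply, smul_eq_mul, abs_mul, ENNReal.ofReal_mul (abs_nonneg t)]

theorem elpNorm_neg (v : ι → ℝ) : elpNorm p (-v) = elpNorm p v := by
  simp [elpNorm]

theorem elpNorm_add_le (hp₀ : 0 < p) (v w : ι → ℝ) :
    elpNorm p (v + w) ≤ 2 * 2 ^ p.toReal⁻¹ * max (elpNorm p v) (elpNorm p w) := by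
  refine le_trans (eSeqNorm_mono fun i => ?_) (eSeqNorm_add_le hp₀ _ _)
  rw [← ENNReal.ofReal_add (abs_nonneg _) (abs_nonneg _)]
  exact ENNReal.ofReal_le_ofReal (abs_add_le _ _)

theorem elpNorm_pi_single_one [DecidableEq ι] (hp₀ : 0 < p) (i : ι) :
    elpNorm p (Pi.single i (1 : ℝ)) = 1 := by
  rw [elpNorm, ← eSeqNorm_pi_single hp₀ i 1]
  congr 1
  ext k
  by_cases hk : k = i
  · subst hk; simp
  · simp [hk]

theorem elpNorm_one [Fintype ι] [Nonempty ι] (hp₀ : 0 < p) :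
    elpNorm p (1 : ι → ℝ) = (Fintype.card ι : ℝ≥0∞) ^ p.toReal⁻¹ := by
  simp [elpNorm, eSeqNorm_const hp₀]

/-- Bounded sets of a finite-dimensional `ℓ^{p₀}` are totally bounded in `ℓ^{p₁}`. -/
theorem exists_finset_elpNorm_sub_le [Fintype ι] [Nonempty ι] {p₀ p₁ A θ : ℝ≥0∞} (hp₀ : 0 < p₀)
    (hp₁ : 0 < p₁) (hA : A ≠ ∞) (hθ : θ ≠ 0) :
    ∃ F : Finset (ι → ℝ), ∀ v, elpNorm p₀ v ≤ A → ∃ y ∈ F, elpNorm p₁ (v - y) ≤ θ := by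
  have hcard : (Fintype.card ι : ℝ≥0∞) ^ p₁.toReal⁻¹ ≠ ∞ :=
    ENNReal.rpow_ne_top_of_nonneg (inv_nonneg.2 ENNReal.toReal_nonneg) (ENNReal.natCast_ne_top _)
  obtain ⟨η, hη, hηθ⟩ := ENNReal.exists_nnreal_pos_mul_lt hcard hθ
  obtain ⟨t, ht, hcover⟩ := Metric.totallyBounded_iff.1
    (isCompact_closedBall (0 : ι → ℝ) A.toReal).totallyBounded η (NNReal.coe_pos.2 hη)
  refine ⟨ht.toFinset, fun v hv => ?_⟩
  have hball : v ∈ Metric.closedBall (0 : ι → ℝ) A.toReal := by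
    rw [mem_closedBall_zero_iff, pi_norm_le_iff_of_nonneg ENNReal.toReal_nonneg]
    intro i
    rw [Real.norm_eq_abs, ← ENNReal.ofReal_le_iff_le_toReal hA]
    exact (le_eSeqNorm hp₀ (fun i => ENNReal.ofReal |v i|) i).trans hv
  obtain ⟨y, hy, hvy⟩ := Set.mem_iUnion₂.1 (hcover hball)
  refine ⟨y, ht.mem_toFinset.2 hy, ?_⟩
  calc elpNorm p₁ (v - y) ≤ eSeqNorm p₁ (fun _ : ι => (η : ℝ≥0∞)) := by
        refine eSeqNorm_mono fun i => ENNReal.ofReal_le_of_le_toReal ?_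
        rw [ENNReal.coe_toReal]
        have := (dist_le_pi_dist v y i).trans (Metric.mem_ball.1 hvy).le
        rwa [Real.dist_eq] at this
    _ = (Fintype.card ι : ℝ≥0∞) ^ p₁.toReal⁻¹ * η := eSeqNorm_const hp₁ _
    _ ≤ θ := by rw [mul_comm]; exact hηθ.le

end BlockNorm

section DyadicPowers

theorem two_rpow_ne_zero (x : ℝ) : (2 : ℝ≥0∞) ^ x ≠ 0 := by simp

theorem two_rpow_ne_top (x : ℝ) : (2 : ℝ≥0∞) ^ x ≠ ∞ := by simp

theorem two_rpow_add (x y : ℝ) : (2 : ℝ≥0∞) ^ (x + y) = 2 ^ x * 2 ^ y :=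
  ENNReal.rpow_add x y two_ne_zero ENNReal.ofNat_ne_top

theorem ofReal_abs_two_rpow (x : ℝ) : ENNReal.ofReal |(2 : ℝ) ^ x| = 2 ^ x := by
  rw [abs_of_pos (by positivity), ← ENNReal.ofReal_rpow_of_pos two_pos, ENNReal.ofReal_ofNat]

theorem two_rpow_natCast_mul (j : ℕ) (x : ℝ) : (2 : ℝ≥0∞) ^ ((j : ℝ) * x) = (2 ^ x) ^ j := by
  rw [mul_comm, ENNReal.rpow_mul, ENNReal.rpow_natCast]

theorem two_rpow_neg_lt_one {δ : ℝ} (hδ : 0 < δ) : (2 : ℝ≥0∞) ^ (-δ) < 1 :=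
  ENNReal.rpow_lt_one_of_one_lt_of_neg ENNReal.one_lt_two (neg_neg_of_pos hδ)

theorem exists_two_rpow_lt {δ : ℝ} (hδ : 0 < δ) {c : ℝ≥0∞} (hc : c ≠ 0) :
    ∃ J : ℕ, (2 : ℝ≥0∞) ^ ((J : ℝ) * -δ) < c := by
  have h := (ENNReal.tendsto_pow_atTop_nhds_zero_of_lt_one
    (two_rpow_neg_lt_one hδ)).eventually_lt_const (pos_iff_ne_zero.2 hc)
  obtain ⟨J, hJ⟩ := h.exists
  exact ⟨J, by rwa [two_rpow_natCast_mul]⟩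

theorem eSeqNorm_two_rpow_ne_top {δ : ℝ} (hδ : 0 < δ) {q : ℝ≥0∞} (hq₀ : 0 < q) :
    eSeqNorm q (fun j : ℕ => (2 : ℝ≥0∞) ^ ((j : ℝ) * -δ)) ≠ ∞ := by
  rcases eq_or_ne q ∞ with rfl | hq
  · rw [eSeqNorm_top]
    refine ne_top_of_le_ne_top ENNReal.one_ne_top (iSup_le fun j => ?_)
    rw [two_rpow_natCast_mul]
    exact pow_le_one₀ zero_le (two_rpow_neg_lt_one hδ).le
  · have hpos := ENNReal.toReal_pos hq₀.ne' hq
    rw [eSeqNorm_of_ne_top hq]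
    refine ENNReal.rpow_ne_top_of_nonneg (inv_nonneg.2 hpos.le) ?_
    have hterm : ∀ j : ℕ, ((2 : ℝ≥0∞) ^ ((j : ℝ) * -δ)) ^ q.toReal =
        (2 ^ (-(δ * q.toReal))) ^ j := by
      intro j
      rw [← ENNReal.rpow_mul, ← two_rpow_natCast_mul]
      ring_nf
    simp_rw [hterm]
    rw [ENNReal.tsum_geometric, ENNReal.inv_ne_top]
    exact (tsub_pos_of_lt (two_rpow_neg_lt_one (mul_pos hδ hpos))).ne'

/-- If `q₁ < q₀`, the sequence `(j + 1) ^ (-1 / q₁)` lies in `ℓ^{q₀}` but not in `ℓ^{q₁}`. -/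
theorem exists_eSeqNorm_ne_top_and_eq_top {q₀ q₁ : ℝ≥0∞} (hq₁ : 0 < q₁) (hlt : q₁ < q₀) :
    ∃ t : ℕ → ℝ, eSeqNorm q₀ (fun j => ENNReal.ofReal |t j|) ≠ ∞ ∧
      eSeqNorm q₁ (fun j => ENNReal.ofReal |t j|) = ∞ := by
  have hq₁' : q₁ ≠ ∞ := hlt.ne_top
  have hpos := ENNReal.toReal_pos hq₁.ne' hq₁'
  have habs : ∀ j : ℕ, |((j + 1 : ℕ) : ℝ) ^ (-q₁.toReal⁻¹)| = ((j + 1 : ℕ) : ℝ) ^ (-q₁.toReal⁻¹) :=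
    fun j => abs_of_pos (by positivity)
  have hpow : ∀ (j : ℕ) (r : ℝ), ENNReal.ofReal |((j + 1 : ℕ) : ℝ) ^ (-q₁.toReal⁻¹)| ^ r =
      ENNReal.ofReal ((((j + 1 : ℕ) : ℝ) ^ (r / q₁.toReal))⁻¹) := by
    intro j r
    rw [habs, ENNReal.ofReal_rpow_of_pos (by positivity), ← Real.rpow_mul (by positivity),
      ← Real.rpow_neg (by positivity)]
    congr 2
    ring
  refine ⟨fun j => ((j + 1 : ℕ) : ℝ) ^ (-q₁.toReal⁻¹), ?_, ?_⟩
  · rcases eq_or_ne q₀ ∞ with rfl | hq₀'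
    · rw [eSeqNorm_top]
      refine ne_top_of_le_ne_top ENNReal.one_ne_top (iSup_le fun j => ?_)
      rw [habs, ENNReal.ofReal_le_one]
      exact Real.rpow_le_one_of_one_le_of_nonpos (by simp) (by simp)
    · rw [eSeqNorm_of_ne_top hq₀']
      refine ENNReal.rpow_ne_top_of_nonneg (inv_nonneg.2 ENNReal.toReal_nonneg) ?_
      simp_rw [hpow]
      refine Summable.tsum_ofReal_ne_top ?_
      refine (summable_nat_add_iff 1).2 (Real.summable_nat_rpow_inv.2 ?_)
      rw [one_lt_div hpos]
      exact (ENNReal.toReal_lt_toReal hq₁' hq₀').2 hlt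
  · rw [eSeqNorm_of_ne_top hq₁', ENNReal.rpow_eq_top_iff_of_pos (inv_pos.2 hpos)]
    simp_rw [hpow, div_self hpos.ne', Real.rpow_one]
    by_contra h
    have hs := ENNReal.summable_toReal h
    refine Real.not_summable_one_div_natCast ((summable_nat_add_iff 1).1 (hs.congr fun j => ?_))
    rw [ENNReal.toReal_ofReal (by positivity), one_div]

end DyadicPowers

section BesovBlocks

variable {n : ℕ} {s₀ s₁ : ℝ} {p₀ p₁ q₀ q₁ : ℝ≥0∞}

/-- The norm of the `j`-th block of the Besov sequence space. -/
noncomputable def blockNorm (n : ℕ) (s : ℝ) (p : ℝ≥0∞) (j : ℕ) (v : Fin (2 ^ (n * j)) → ℝ) :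
    ℝ≥0∞ :=
  (2 : ℝ≥0∞) ^ ((j : ℝ) * (s - n * p.toReal⁻¹)) * elpNorm p v

/-- The excess of `s₀ - s₁` over the critical smoothness difference. -/
noncomputable def smoothnessGap (n : ℕ) (s₀ s₁ : ℝ) (p₀ p₁ : ℝ≥0∞) : ℝ :=
  s₀ - s₁ - max 0 ((n : ℝ) * p₀.toReal⁻¹ - n * p₁.toReal⁻¹)

theorem besovNormFin_eq (n : ℕ) (s : ℝ) (p q : ℝ≥0∞) (x : ∀ j : ℕ, Fin (2 ^ (n * j)) → ℝ) :
    besovNormFin n s p q x = eSeqNorm q fun j => blockNorm n s p j (x j) := rfl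

theorem blockNorm_smul (hp₀ : 0 < p₀) (j : ℕ) (t : ℝ) (v : Fin (2 ^ (n * j)) → ℝ) :
    blockNorm n s₀ p₀ j (t • v) = ENNReal.ofReal |t| * blockNorm n s₀ p₀ j v := by
  rw [blockNorm, blockNorm, elpNorm_smul hp₀, mul_left_comm]

theorem card_block_rpow (n j : ℕ) (r : ℝ) :
    (Fintype.card (Fin (2 ^ (n * j))) : ℝ≥0∞) ^ r = 2 ^ ((j : ℝ) * (n * r)) := by
  rw [Fintype.card_fin, Nat.cast_pow, Nat.cast_ofNat, ← ENNReal.rpow_natCast, ← ENNReal.rpow_mul]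
  push_cast
  ring_nf

theorem elpNorm_le_two_rpow_mul (hp₀ : 0 < p₀) (hp₁ : 0 < p₁) (j : ℕ)
    (v : Fin (2 ^ (n * j)) → ℝ) :
    elpNorm p₁ v ≤
      2 ^ ((j : ℝ) * max 0 ((n : ℝ) * p₁.toReal⁻¹ - n * p₀.toReal⁻¹)) * elpNorm p₀ v := by
  rcases le_total p₀ p₁ with h | h
  · calc elpNorm p₁ v ≤ 1 * elpNorm p₀ v := by
          rw [one_mul]; exact eSeqNorm_le_of_le hp₀ h _
      _ ≤ _ := by
          gcongr
          rw [← ENNReal.rpow_zero (x := 2)]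
          exact ENNReal.rpow_le_rpow_of_exponent_le one_le_two (by positivity)
  · refine (eSeqNorm_le_card_rpow_mul hp₁ h _).trans ?_
    rw [card_block_rpow, mul_sub (n : ℝ)]
    unfold elpNorm
    gcongr
    · exact one_le_two
    · exact le_max_right _ _

theorem blockNorm_le (hp₀ : 0 < p₀) (hp₁ : 0 < p₁) (j : ℕ) (v : Fin (2 ^ (n * j)) → ℝ) :
    blockNorm n s₁ p₁ j v ≤
      2 ^ ((j : ℝ) * -smoothnessGap n s₀ s₁ p₀ p₁) * blockNorm n s₀ p₀ j v := by
  unfold blockNorm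
  refine (mul_le_mul_right (elpNorm_le_two_rpow_mul hp₀ hp₁ j v) _).trans ?_
  rw [← mul_assoc, ← mul_assoc, ← two_rpow_add, ← two_rpow_add]
  refine mul_le_mul_left (le_of_eq ?_) _
  congr 1
  rw [smoothnessGap, ← mul_add, ← mul_add]
  congr 1
  rcases le_total ((n : ℝ) * p₀.toReal⁻¹) (n * p₁.toReal⁻¹) with h | h
  · rw [max_eq_right (sub_nonneg.2 h), max_eq_left (sub_nonpos.2 h)]; ring
  · rw [max_eq_left (sub_nonpos.2 h), max_eq_right (sub_nonneg.2 h)]; ring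

/-- The estimate `blockNorm_le` is attained in every block. -/
theorem exists_blockNorm_eq (n : ℕ) (s₀ s₁ : ℝ) (hp₀ : 0 < p₀) (hp₁ : 0 < p₁) (j : ℕ) :
    ∃ v : Fin (2 ^ (n * j)) → ℝ, blockNorm n s₀ p₀ j v = 1 ∧
      blockNorm n s₁ p₁ j v = 2 ^ ((j : ℝ) * -smoothnessGap n s₀ s₁ p₀ p₁) := by
  rcases le_total ((n : ℝ) * p₀.toReal⁻¹) (n * p₁.toReal⁻¹) with h | h
  · refine ⟨(2 : ℝ) ^ ((j : ℝ) * -s₀) • (1 : Fin (2 ^ (n * j)) → ℝ), ?_, ?_⟩ <;>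
    rw [blockNorm_smul (by assumption), blockNorm, elpNorm_one (by assumption), card_block_rpow,
      ofReal_abs_two_rpow, ← two_rpow_add, ← two_rpow_add]
    · rw [← ENNReal.rpow_zero (x := 2)]
      ring_nf
    · rw [smoothnessGap, max_eq_left (sub_nonpos.2 h)]
      ring_nf
  · refine ⟨(2 : ℝ) ^ ((j : ℝ) * (n * p₀.toReal⁻¹ - s₀)) •
      Pi.single (⟨0, by positivity⟩ : Fin (2 ^ (n * j))) (1 : ℝ), ?_, ?_⟩ <;>
    rw [blockNorm_smul (by assumption), blockNorm, elpNorm_pi_single_one (by assumption), mul_one,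
      ofReal_abs_two_rpow, ← two_rpow_add]
    · rw [← ENNReal.rpow_zero (x := 2)]
      ring_nf
    · rw [smoothnessGap, max_eq_right (sub_nonneg.2 h)]
      ring_nf

/-- Scalar sequences embed isometrically into the Besov sequence space along extremal blocks. -/
theorem exists_extremal_blocks (n : ℕ) (s₀ s₁ : ℝ) (hp₀ : 0 < p₀) (hp₁ : 0 < p₁) (q₀ q₁ : ℝ≥0∞) :
    ∃ e : ∀ j : ℕ, Fin (2 ^ (n * j)) → ℝ,
      (∀ j, blockNorm n s₁ p₁ j (e j) = 2 ^ ((j : ℝ) * -smoothnessGap n s₀ s₁ p₀ p₁)) ∧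
      ∀ t : ℕ → ℝ,
        besovNormFin n s₀ p₀ q₀ (fun j => t j • e j) =
          eSeqNorm q₀ (fun j => ENNReal.ofReal |t j|) ∧
        besovNormFin n s₁ p₁ q₁ (fun j => t j • e j) =
          eSeqNorm q₁ (fun j => ENNReal.ofReal |t j| *
            2 ^ ((j : ℝ) * -smoothnessGap n s₀ s₁ p₀ p₁)) := by
  choose e he₀ he₁ using exists_blockNorm_eq n s₀ s₁ hp₀ hp₁
  refine ⟨e, he₁, fun t => ⟨?_, ?_⟩⟩
  · simp_rw [besovNormFin_eq, blockNorm_smul hp₀, he₀, mul_one]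
  · simp_rw [besovNormFin_eq, blockNorm_smul hp₁, he₁]

theorem besovNormFin_ne_top_of_gap_eq_zero (hp₀ : 0 < p₀) (hp₁ : 0 < p₁) (hq₀ : 0 < q₀)
    (hgap : smoothnessGap n s₀ s₁ p₀ p₁ = 0) (hq : q₀ ≤ q₁)
    {x : ∀ j : ℕ, Fin (2 ^ (n * j)) → ℝ} (hx : besovNormFin n s₀ p₀ q₀ x ≠ ∞) :
    besovNormFin n s₁ p₁ q₁ x ≠ ∞ := by
  refine ne_top_of_le_ne_top hx ?_
  rw [besovNormFin_eq, besovNormFin_eq]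
  refine (eSeqNorm_mono fun j => ?_).trans (eSeqNorm_le_of_le hq₀ hq _)
  simpa [hgap] using blockNorm_le (s₀ := s₀) (s₁ := s₁) hp₀ hp₁ j (x j)

theorem besovNormFin_ne_top_of_gap_pos (hp₀ : 0 < p₀) (hp₁ : 0 < p₁) (hq₀ : 0 < q₀)
    (hq₁ : 0 < q₁) (hgap : 0 < smoothnessGap n s₀ s₁ p₀ p₁)
    {x : ∀ j : ℕ, Fin (2 ^ (n * j)) → ℝ} (hx : besovNormFin n s₀ p₀ q₀ x ≠ ∞) :
    besovNormFin n s₁ p₁ q₁ x ≠ ∞ := by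
  refine ne_top_of_le_ne_top (ENNReal.mul_ne_top hx (eSeqNorm_two_rpow_ne_top hgap hq₁)) ?_
  rw [← eSeqNorm_const_mul hq₁, besovNormFin_eq n s₁]
  refine eSeqNorm_mono fun j => (blockNorm_le (s₀ := s₀) hp₀ hp₁ j (x j)).trans ?_
  rw [mul_comm]
  gcongr
  exact le_eSeqNorm hq₀ (fun j => blockNorm n s₀ p₀ j (x j)) j

theorem gap_nonneg_of_inclusion (hp₀ : 0 < p₀) (hp₁ : 0 < p₁) (hq₀ : 0 < q₀) (hq₁ : 0 < q₁)
    (hincl : ∀ x : ∀ j : ℕ, Fin (2 ^ (n * j)) → ℝ,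
      besovNormFin n s₀ p₀ q₀ x ≠ ∞ → besovNormFin n s₁ p₁ q₁ x ≠ ∞) :
    0 ≤ smoothnessGap n s₀ s₁ p₀ p₁ := by
  obtain ⟨e, -, he⟩ := exists_extremal_blocks n s₀ s₁ hp₀ hp₁ q₀ q₁
  by_contra! hneg
  set δ := smoothnessGap n s₀ s₁ p₀ p₁
  obtain ⟨h₀, h₁⟩ := he fun j => (2 : ℝ) ^ ((j : ℝ) * -(-δ / 2))
  simp_rw [ofReal_abs_two_rpow] at h₀ h₁
  have hfin := hincl _ (h₀.trans_ne (eSeqNorm_two_rpow_ne_top (by linarith) hq₀))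
  rw [h₁] at hfin
  obtain ⟨J, hJ⟩ := exists_two_rpow_lt (δ := -δ / 2) (by linarith) (ENNReal.inv_ne_zero.2 hfin)
  refine hJ.not_ge (ENNReal.inv_le_iff_inv_le.1 ?_)
  refine le_trans (le_of_eq ?_) (le_eSeqNorm hq₁ _ J)
  rw [← two_rpow_add, ← ENNReal.rpow_neg]
  ring_nf

theorem le_of_inclusion_of_gap_eq_zero (hp₀ : 0 < p₀) (hp₁ : 0 < p₁) (hq₁ : 0 < q₁)
    (hgap : smoothnessGap n s₀ s₁ p₀ p₁ = 0)
    (hincl : ∀ x : ∀ j : ℕ, Fin (2 ^ (n * j)) → ℝ,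
      besovNormFin n s₀ p₀ q₀ x ≠ ∞ → besovNormFin n s₁ p₁ q₁ x ≠ ∞) :
    q₀ ≤ q₁ := by
  by_contra! hlt
  obtain ⟨e, -, he⟩ := exists_extremal_blocks n s₀ s₁ hp₀ hp₁ q₀ q₁
  obtain ⟨t, ht₀, ht₁⟩ := exists_eSeqNorm_ne_top_and_eq_top hq₁ hlt
  obtain ⟨h₀, h₁⟩ := he t
  refine hincl _ (h₀.trans_ne ht₀) (h₁.trans ?_)
  simpa [hgap] using ht₁

theorem normCompact_of_gap_pos (hp₀ : 0 < p₀) (hp₁ : 0 < p₁) (hq₀ : 0 < q₀) (hq₁ : 0 < q₁)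
    (hgap : 0 < smoothnessGap n s₀ s₁ p₀ p₁) :
    NormCompact (besovNormFin n s₀ p₀ q₀) (besovNormFin n s₁ p₁ q₁)
      (LinearMap.id : (∀ j : ℕ, Fin (2 ^ (n * j)) → ℝ) →ₗ[ℝ] _) := by
  intro ε hε
  set δ := smoothnessGap n s₀ s₁ p₀ p₁
  obtain ⟨c, hc, hcε⟩ := ENNReal.exists_nnreal_pos_mul_lt
    (eSeqNorm_two_rpow_ne_top (half_pos hgap) hq₁) (ENNReal.ofReal_pos.2 hε).ne'
  have hc₀ : (c : ℝ≥0∞) ≠ 0 := ENNReal.coe_ne_zero.2 hc.ne'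
  obtain ⟨J, hJ⟩ := exists_two_rpow_lt (half_pos hgap) hc₀
  have hnet : ∀ j : ℕ, ∃ F : Finset (Fin (2 ^ (n * j)) → ℝ), ∀ v, blockNorm n s₀ p₀ j v ≤ 1 →
      ∃ y ∈ F, blockNorm n s₁ p₁ j (v - y) ≤ c * 2 ^ ((j : ℝ) * -(δ / 2)) := by
    intro j
    obtain ⟨F, hF⟩ := exists_finset_elpNorm_sub_le (ι := Fin (2 ^ (n * j)))
      (A := 1 / 2 ^ ((j : ℝ) * (s₀ - n * p₀.toReal⁻¹)))
      (θ := c * 2 ^ ((j : ℝ) * -(δ / 2)) / 2 ^ ((j : ℝ) * (s₁ - n * p₁.toReal⁻¹))) hp₀ hp₁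
      (ENNReal.div_ne_top ENNReal.one_ne_top (two_rpow_ne_zero _))
      (ENNReal.div_ne_zero.2 ⟨mul_ne_zero hc₀ (two_rpow_ne_zero _), two_rpow_ne_top _⟩)
    refine ⟨F, fun v hv => ?_⟩
    obtain ⟨y, hy, hvy⟩ := hF v (by
      rwa [ENNReal.le_div_iff_mul_le (.inl (two_rpow_ne_zero _)) (.inl (two_rpow_ne_top _)),
        mul_comm])
    refine ⟨y, hy, ?_⟩
    rwa [ENNReal.le_div_iff_mul_le (.inl (two_rpow_ne_zero _)) (.inl (two_rpow_ne_top _)),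
      mul_comm] at hvy
  choose F hF using hnet
  classical
  refine ⟨(Fintype.piFinset fun j : Fin J => F j).image
    fun z j => if h : j < J then z ⟨j, h⟩ else 0, fun x hx => ?_⟩
  have hblock : ∀ j, blockNorm n s₀ p₀ j (x j) ≤ 1 := fun j =>
    (le_eSeqNorm hq₀ (fun j => blockNorm n s₀ p₀ j (x j)) j).trans hx
  choose y hyF hy using fun j => hF j (x j) (hblock j)
  refine ⟨_, Finset.mem_image_of_mem _ (Fintype.mem_piFinset.2 fun j : Fin J => hyF j),
    lt_of_le_of_lt ?_ hcε⟩
  rw [← eSeqNorm_const_mul hq₁, besovNormFin_eq]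
  refine eSeqNorm_mono fun j => ?_
  by_cases hj : j < J
  · simpa [hj] using hy j
  · have hJj : (J : ℝ) ≤ j := by exact_mod_cast not_lt.1 hj
    have hsmall : (2 : ℝ≥0∞) ^ ((j : ℝ) * -(δ / 2)) ≤ c :=
      (ENNReal.rpow_le_rpow_of_exponent_le one_le_two (by nlinarith)).trans hJ.le
    calc blockNorm n s₁ p₁ j _ = blockNorm n s₁ p₁ j (x j) := by simp [hj]
      _ ≤ 2 ^ ((j : ℝ) * -δ) * blockNorm n s₀ p₀ j (x j) := blockNorm_le hp₀ hp₁ j (x j)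
      _ ≤ 2 ^ ((j : ℝ) * -δ) * 1 := by gcongr; exact hblock j
      _ = 2 ^ ((j : ℝ) * -(δ / 2)) * 2 ^ ((j : ℝ) * -(δ / 2)) := by
          rw [mul_one, ← two_rpow_add]; ring_nf
      _ ≤ c * 2 ^ ((j : ℝ) * -(δ / 2)) := by gcongr

theorem gap_ne_zero_of_normCompact (hp₀ : 0 < p₀) (hp₁ : 0 < p₁) (hq₀ : 0 < q₀) (hq₁ : 0 < q₁)
    (hcomp : NormCompact (besovNormFin n s₀ p₀ q₀) (besovNormFin n s₁ p₁ q₁)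
      (LinearMap.id : (∀ j : ℕ, Fin (2 ^ (n * j)) → ℝ) →ₗ[ℝ] _)) :
    smoothnessGap n s₀ s₁ p₀ p₁ ≠ 0 := by
  intro hgap
  obtain ⟨e, he₁, he⟩ := exists_extremal_blocks n s₀ s₁ hp₀ hp₁ q₀ q₁
  set C : ℝ≥0∞ := 2 * 2 ^ p₁.toReal⁻¹
  have hC₀ : C ≠ 0 := mul_ne_zero two_ne_zero (two_rpow_ne_zero _)
  have hCtop : C ≠ ∞ := ENNReal.mul_ne_top ENNReal.ofNat_ne_top (two_rpow_ne_top _)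
  have hCinv : ENNReal.ofReal C⁻¹.toReal = C⁻¹ := ENNReal.ofReal_toReal (ENNReal.inv_ne_top.2 hC₀)
  obtain ⟨F, hF⟩ := hcomp C⁻¹.toReal
    (ENNReal.toReal_pos (ENNReal.inv_ne_zero.2 hCtop) (ENNReal.inv_ne_top.2 hC₀))
  rw [hCinv] at hF
  have hunit : ∀ j : ℕ,
      besovNormFin n s₀ p₀ q₀ (fun i => (Pi.single j 1 : ℕ → ℝ) i • e i) ≤ 1 := fun j =>
    ((he _).1.trans (elpNorm_pi_single_one hq₀ j)).le
  choose y hyF hy using fun j => hF _ (hunit j)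
  obtain ⟨j, k, hjk, heq⟩ :=
    Finite.exists_ne_map_eq_of_infinite fun j : ℕ => (⟨y j, hyF j⟩ : F)
  have heq : y j = y k := congrArg Subtype.val heq
  have hj := (le_eSeqNorm hq₁ _ k).trans_lt (hy j)
  have hk := (le_eSeqNorm hq₁ _ k).trans_lt (hy k)
  have hadd := elpNorm_add_le hp₁ (e k - y k k) (y k k)
  simp only [LinearMap.id_apply, Pi.sub_apply, Pi.single_eq_same, one_smul,
    Pi.single_eq_of_ne hjk.symm, zero_smul, zero_sub, elpNorm_neg, heq] at hj hk
  rw [sub_add_cancel] at hadd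
  have hone : blockNorm n s₁ p₁ k (e k) < 1 := by
    calc blockNorm n s₁ p₁ k (e k)
        ≤ 2 ^ ((k : ℝ) * (s₁ - n * p₁.toReal⁻¹)) *
            (C * max (elpNorm p₁ (e k - y k k)) (elpNorm p₁ (y k k))) := by
          unfold blockNorm; gcongr
      _ = C * max (2 ^ ((k : ℝ) * (s₁ - n * p₁.toReal⁻¹)) * elpNorm p₁ (e k - y k k))
            (2 ^ ((k : ℝ) * (s₁ - n * p₁.toReal⁻¹)) * elpNorm p₁ (y k k)) := by
          rw [mul_left_comm, mul_max]
      _ < 1 := ENNReal.mul_lt_of_lt_div' (by rw [one_div]; exact max_lt hk hj)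
  simp [he₁, hgap] at hone

end BesovBlocks

theorem statement16 (n : ℕ) (hn : 1 ≤ n) (s₀ s₁ : ℝ) (p₀ p₁ q₀ q₁ : ℝ≥0∞)
    (hp₀ : 0 < p₀) (hp₁ : 0 < p₁) (hq₀ : 0 < q₀) (hq₁ : 0 < q₁) :
    ((∀ x : ∀ j : ℕ, Fin (2 ^ (n * j)) → ℝ,
        besovNormFin n s₀ p₀ q₀ x ≠ ∞ → besovNormFin n s₁ p₁ q₁ x ≠ ∞)
      ↔ ((s₀ - s₁ = max 0 ((n : ℝ) * p₀.toReal⁻¹ - n * p₁.toReal⁻¹) ∧ q₀ ≤ q₁)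
          ∨ s₀ - s₁ > max 0 ((n : ℝ) * p₀.toReal⁻¹ - n * p₁.toReal⁻¹)))
    ∧ ((∀ x : ∀ j : ℕ, Fin (2 ^ (n * j)) → ℝ,
          besovNormFin n s₀ p₀ q₀ x ≠ ∞ → besovNormFin n s₁ p₁ q₁ x ≠ ∞) →
        (NormCompact (besovNormFin n s₀ p₀ q₀) (besovNormFin n s₁ p₁ q₁)
            (LinearMap.id : (∀ j : ℕ, Fin (2 ^ (n * j)) → ℝ) →ₗ[ℝ] _)
          ↔ s₀ - s₁ > max 0 ((n : ℝ) * p₀.toReal⁻¹ - n * p₁.toReal⁻¹))) := by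
  have hpos : s₀ - s₁ > max 0 ((n : ℝ) * p₀.toReal⁻¹ - n * p₁.toReal⁻¹) ↔
      0 < smoothnessGap n s₀ s₁ p₀ p₁ := sub_pos.symm
  have hzero : s₀ - s₁ = max 0 ((n : ℝ) * p₀.toReal⁻¹ - n * p₁.toReal⁻¹) ↔
      smoothnessGap n s₀ s₁ p₀ p₁ = 0 := sub_eq_zero.symm
  rw [hpos, hzero]
  refine ⟨⟨fun hincl => ?_, ?_⟩, fun hincl =>
    ⟨fun hcomp => ?_, normCompact_of_gap_pos hp₀ hp₁ hq₀ hq₁⟩⟩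
  · rcases (gap_nonneg_of_inclusion hp₀ hp₁ hq₀ hq₁ hincl).eq_or_lt' with h | h
    · exact .inl ⟨h, le_of_inclusion_of_gap_eq_zero hp₀ hp₁ hq₁ h hincl⟩
    · exact .inr h
  · rintro (⟨h, hq⟩ | h) x hx
    · exact besovNormFin_ne_top_of_gap_eq_zero hp₀ hp₁ hq₀ h hq hx
    · exact besovNormFin_ne_top_of_gap_pos hp₀ hp₁ hq₀ hq₁ h hx
  · exact (gap_nonneg_of_inclusion hp₀ hp₁ hq₀ hq₁ hincl).lt_of_ne'
      (gap_ne_zero_of_normCompact hp₀ hp₁ hq₀ hq₁ hcomp)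

end Stmt16
end
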